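/- Let p > 1, f(u) = (1−u)^{−p} on [0,1), and Ω an arbitrary bounded smooth domain in ℝⁿ. If (u_m) is a sequence of semistable solutions of (N_{λ_m}) satisfying the stability inequality, then sup_m ‖u_m‖_{L^∞(Ω)} < 1 whenever n < 4α* + 2, where α* is the largest real root of the polynomial α⁴ − (8p(p−1)/(p+1)²)α² + (4p(p−1)(p−3)/(p+1)³)α + 4p(p−1)²/(p+1)⁴. -/

import Mathlib

open MeasureTheory Filter Topology Real Set

noncomputable section

/-- The Laplacian of a real-valued function on Euclidean space. -/
def lap {n : ℕ} (u : EuclideanSpace ℝ (Fin n) → ℝ) (x : EuclideanSpace ℝ (Fin n)) : ℝ :=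
  ∑ i : Fin n, iteratedFDeriv ℝ 2 u x ![EuclideanSpace.single i (1:ℝ), EuclideanSpace.single i (1:ℝ)]

/-- A bounded (smooth) domain. -/
def GoodDomain {n : ℕ} (Ω : Set (EuclideanSpace ℝ (Fin n))) : Prop :=
  IsOpen Ω ∧ Bornology.IsBounded Ω ∧ Ω.Nonempty

/-- The domain `[0, a_f)` of the nonlinearity. -/
def domf (a : EReal) : Set ℝ := {t : ℝ | 0 ≤ t ∧ (t : EReal) < a}

/-- The filter of `t → a_f⁻`. -/
def afFilter (a : EReal) : Filter ℝ :=
  if a = ⊤ then Filter.atTop else nhdsWithin a.toReal (Set.Iio a.toReal)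

/-- Hypothesis (H) on the nonlinearity `f : [0, a_f) → ℝ₊`. -/
structure HypH (a : EReal) (f : ℝ → ℝ) : Prop where
  a_pos : 0 < a
  smooth : ContDiffOn ℝ (⊤ : ℕ∞) f (domf a)
  mono : StrictMonoOn f (domf a)
  convex : ConvexOn ℝ (domf a) f
  f0_pos : 0 < f 0
  pos : ∀ t ∈ domf a, 0 < f t
  blowup : Filter.Tendsto f (afFilter a) Filter.atTop
  superlinear : a = ⊤ → Filter.Tendsto (fun t => f t / t) Filter.atTop Filter.atTop

/-- `τ₋ = liminf_{t → a_f} f f'' / (f')²`. -/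
def tauMinus (a : EReal) (f : ℝ → ℝ) : ℝ :=
  Filter.liminf (fun t => f t * deriv (deriv f) t / (deriv f t) ^ 2) (afFilter a)

/-- `τ₊ = limsup_{t → a_f} f f'' / (f')²`. -/
def tauPlus (a : EReal) (f : ℝ → ℝ) : ℝ :=
  Filter.limsup (fun t => f t * deriv (deriv f) t / (deriv f t) ^ 2) (afFilter a)

/-- `u` is a (smooth, `[0,a_f)`-valued) solution of `Δ²u = λ f(u)` in `Ω`,
`u = Δu = 0` on `∂Ω`. -/
def Solves {n : ℕ} (Ω : Set (EuclideanSpace ℝ (Fin n))) (a : EReal) (lam : ℝ)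
    (f : ℝ → ℝ) (u : EuclideanSpace ℝ (Fin n) → ℝ) : Prop :=
  ContDiff ℝ (⊤ : ℕ∞) u ∧ (∀ x ∈ Ω, 0 ≤ u x ∧ (u x : EReal) < a) ∧
  (∀ x ∈ Ω, lap (lap u) x = lam * f (u x)) ∧
  (∀ x ∈ frontier Ω, u x = 0) ∧ (∀ x ∈ frontier Ω, lap u x = 0)

/-- `u` is a semistable solution: the second variation is nonnegative over
test functions in `H² ∩ H¹₀` (modelled by smooth functions vanishing on `∂Ω`). -/
def Semistable {n : ℕ} (Ω : Set (EuclideanSpace ℝ (Fin n))) (lam : ℝ)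
    (f : ℝ → ℝ) (u : EuclideanSpace ℝ (Fin n) → ℝ) : Prop :=
  ∀ φ : EuclideanSpace ℝ (Fin n) → ℝ, ContDiff ℝ (⊤ : ℕ∞) φ → (∀ x ∈ frontier Ω, φ x = 0) →
    0 ≤ ∫ x in Ω, ((lap φ x) ^ 2 - lam * deriv f (u x) * (φ x) ^ 2)

/-- `u` satisfies the stability inequality
`√λ ∫ √(f'(u)) φ² ≤ ∫ |∇φ|²` for all `φ ∈ H¹₀(Ω)`
(modelled by smooth compactly supported test functions). -/
def StabIneq {n : ℕ} (Ω : Set (EuclideanSpace ℝ (Fin n))) (lam : ℝ)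
    (f : ℝ → ℝ) (u : EuclideanSpace ℝ (Fin n) → ℝ) : Prop :=
  ∀ φ : EuclideanSpace ℝ (Fin n) → ℝ, ContDiff ℝ (⊤ : ℕ∞) φ → HasCompactSupport φ →
    tsupport φ ⊆ Ω →
    Real.sqrt lam * ∫ x in Ω, Real.sqrt (deriv f (u x)) * (φ x) ^ 2 ≤
      ∫ x in Ω, ‖gradient φ x‖ ^ 2

/-- The quartic polynomial `P_f(α, τ₋, τ₊)`. -/
def Pf (τm τp α : ℝ) : ℝ :=
  (2 - τm) ^ 2 * α ^ 4 - 8 * (2 - τp) * α ^ 2 + 4 * (4 - 3 * τp) * α - 4 * (1 - τp)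

/-- `F(t) = ∫₀ᵗ f(s) ds`. -/
def Fint (f : ℝ → ℝ) (t : ℝ) : ℝ := ∫ s in (0:ℝ)..t, f s

/-- `f̃(t) = f(t) - f(0)`. -/
def ftil (f : ℝ → ℝ) (t : ℝ) : ℝ := f t - f 0

/-- `Θ(t) = ∫₀ᵗ θ'(s)² ds`. -/
def Theta (θ : ℝ → ℝ) (t : ℝ) : ℝ := ∫ s in (0:ℝ)..t, (deriv θ s) ^ 2

/-- Partial derivative. -/
def pd {n : ℕ} (i : Fin n) (u : EuclideanSpace ℝ (Fin n) → ℝ) (x : EuclideanSpace ℝ (Fin n)) : ℝ :=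
  fderiv ℝ u x (EuclideanSpace.single i (1:ℝ))

theorem pd_smooth {n : ℕ} (i : Fin n) {u : EuclideanSpace ℝ (Fin n) → ℝ}
    (hu : ContDiff ℝ (⊤ : ℕ∞) u) : ContDiff ℝ (⊤ : ℕ∞) (pd i u) := by
  unfold pd
  have h : ContDiff ℝ (⊤ : ℕ∞) (fderiv ℝ u) := (contDiff_infty_iff_fderiv.1 hu).2
  exact h.clm_apply contDiff_const

theorem lap_eq_pd {n : ℕ} {u : EuclideanSpace ℝ (Fin n) → ℝ}
    (hu : ContDiff ℝ (⊤ : ℕ∞) u) (x : EuclideanSpace ℝ (Fin n)) :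
    lap u x = ∑ i, pd i (pd i u) x := by
  unfold lap
  refine Finset.sum_congr rfl fun i _ => ?_
  rw [iteratedFDeriv_two_apply]
  have h : ContDiff ℝ (⊤ : ℕ∞) (fderiv ℝ u) := (contDiff_infty_iff_fderiv.1 hu).2
  have hd : DifferentiableAt ℝ (fderiv ℝ u) x := (h.differentiable (by simp)) x
  simp only [pd, Matrix.cons_val_zero, Matrix.cons_val_one]
  have := (hd.hasFDerivAt.clm_apply
    (hasFDerivAt_const (EuclideanSpace.single i (1:ℝ) : EuclideanSpace ℝ (Fin n)) x)).fderiv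
  have h2 : (fun x => fderiv ℝ u x (EuclideanSpace.single i (1:ℝ)))
    = (fun y => (fderiv ℝ u y) (EuclideanSpace.single i (1:ℝ))) := rfl
  change _ = (fderiv ℝ (fun x => fderiv ℝ u x (EuclideanSpace.single i (1:ℝ))) x) _
  rw [this]
  simp

theorem lap_smooth {n : ℕ} {u : EuclideanSpace ℝ (Fin n) → ℝ}
    (hu : ContDiff ℝ (⊤ : ℕ∞) u) : ContDiff ℝ (⊤ : ℕ∞) (lap u) := by
  have : lap u = fun x => ∑ i, pd i (pd i u) x := funext fun x => lap_eq_pd hu x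
  rw [this]
  exact ContDiff.sum fun i _ => pd_smooth i (pd_smooth i hu)

theorem norm_gradient_sq {n : ℕ} (u : EuclideanSpace ℝ (Fin n) → ℝ)
    (x : EuclideanSpace ℝ (Fin n)) : ‖gradient u x‖ ^ 2 = ∑ i, pd i u x ^ 2 := by
  rw [EuclideanSpace.norm_sq_eq]
  refine Finset.sum_congr rfl fun i _ => ?_
  have h : inner ℝ (gradient u x) (EuclideanSpace.single i (1:ℝ)) = pd i u x :=
    inner_gradient_left
  rw [EuclideanSpace.inner_single_right] at h
  simp at h
  rw [← h]; simp

theorem pd_compactSupport {n : ℕ} (i : Fin n) {φ : EuclideanSpace ℝ (Fin n) → ℝ}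
    (hc : HasCompactSupport φ) : HasCompactSupport (pd i φ) :=
  hc.fderiv_apply ℝ _

/-- Green's first identity for test functions. -/
theorem ibp {n : ℕ} {φ u : EuclideanSpace ℝ (Fin n) → ℝ}
    (hφ : ContDiff ℝ (⊤ : ℕ∞) φ) (hc : HasCompactSupport φ) (hu : ContDiff ℝ (⊤ : ℕ∞) u) :
    ∫ x, φ x * lap u x = - ∫ x, ∑ i, pd i φ x * pd i u x := by
  have hcφ : Continuous φ := hφ.continuous
  have hI : ∀ i : Fin n, Integrable (fun x => pd i φ x * pd i u x) := fun i =>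
    ((pd_smooth i hφ).continuous.mul (pd_smooth i hu).continuous).integrable_of_hasCompactSupport
      (pd_compactSupport i hc).mul_right
  have hI2 : ∀ i : Fin n, Integrable (fun x => φ x * pd i (pd i u) x) := fun i =>
    (hcφ.mul (pd_smooth i (pd_smooth i hu)).continuous).integrable_of_hasCompactSupport
      hc.mul_right
  have hI3 : ∀ i : Fin n, Integrable (fun x => φ x * (pd i u) x) := fun i =>
    (hcφ.mul (pd_smooth i hu).continuous).integrable_of_hasCompactSupport
      hc.mul_right
  simp_rw [lap_eq_pd hu, Finset.mul_sum]
  rw [integral_finsetSum _ fun i _ => hI2 i, integral_finsetSum _ fun i _ => hI i,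
    ← Finset.sum_neg_distrib]
  refine Finset.sum_congr rfl fun i _ => ?_
  exact integral_mul_fderiv_eq_neg_fderiv_mul_of_integrable (hI i) (hI2 i) (hI3 i)
    (fun x _ => (hφ.differentiable (by simp)) x)
    (fun x _ => ((pd_smooth i hu).differentiable (by simp)) x)

/-- Extension by zero of a function that vanishes near the boundary. -/
theorem ext_zero {n : ℕ} {Ω : Set (EuclideanSpace ℝ (Fin n))} (hO : IsOpen Ω)
    (hB : Bornology.IsBounded Ω) {w : EuclideanSpace ℝ (Fin n) → ℝ} (hw : Continuous w)
    (hw0 : ∀ x ∈ frontier Ω, w x = 0) {ε : ℝ} (hε : 0 < ε)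
    {F : EuclideanSpace ℝ (Fin n) → ℝ} (hF : ContDiffOn ℝ (⊤ : ℕ∞) F Ω)
    (hF0 : ∀ x ∈ Ω, w x < ε → F x = 0) :
    ContDiff ℝ (⊤ : ℕ∞) (Ω.indicator F) ∧ HasCompactSupport (Ω.indicator F) ∧
      tsupport (Ω.indicator F) ⊆ Ω := by
  set K : Set (EuclideanSpace ℝ (Fin n)) := closure Ω ∩ w ⁻¹' (Ici ε) with hK
  have hKc : IsClosed K := isClosed_closure.inter (isClosed_Ici.preimage hw)
  have hKΩ : K ⊆ Ω := by
    rintro x ⟨hx1, hx2⟩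
    by_contra hx
    have : x ∈ frontier Ω := by rw [hO.frontier_eq]; exact ⟨hx1, hx⟩
    have := hw0 x this
    simp only [mem_preimage, mem_Ici] at hx2
    linarith
  have hsup : Function.support (Ω.indicator F) ⊆ K := by
    intro x hx
    have hxΩ : x ∈ Ω := by
      by_contra h; exact hx (indicator_of_notMem h _)
    refine ⟨subset_closure hxΩ, ?_⟩
    by_contra h
    simp only [mem_preimage, mem_Ici, not_le] at h
    exact hx (by rw [indicator_of_mem hxΩ]; exact hF0 x hxΩ h)
  have hts : tsupport (Ω.indicator F) ⊆ K := closure_minimal hsup hKc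
  have hKcomp : IsCompact K :=
    (hB.isCompact_closure).inter_right (isClosed_Ici.preimage hw)
  refine ⟨?_, hKcomp.of_isClosed_subset (isClosed_tsupport _) hts, hts.trans hKΩ⟩
  rw [contDiff_iff_contDiffAt]
  intro x
  by_cases hx : x ∈ Ω
  · refine ((hF x hx).contDiffAt (hO.mem_nhds hx)).congr_of_eventuallyEq ?_
    filter_upwards [hO.mem_nhds hx] with y hy
    exact indicator_of_mem hy _
  · have : x ∉ tsupport (Ω.indicator F) := fun h => hx (hKΩ (hts h))
    have h0 : Ω.indicator F =ᶠ[𝓝 x] fun _ => 0 := notMem_tsupport_iff_eventuallyEq.1 this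
    exact contDiffAt_const.congr_of_eventuallyEq h0

theorem pd_indicator_mem {n : ℕ} {Ω : Set (EuclideanSpace ℝ (Fin n))} (hO : IsOpen Ω)
    (F : EuclideanSpace ℝ (Fin n) → ℝ) (i : Fin n) {x : EuclideanSpace ℝ (Fin n)} (hx : x ∈ Ω) :
    pd i (Ω.indicator F) x = pd i F x := by
  unfold pd
  have : Ω.indicator F =ᶠ[𝓝 x] F := by
    filter_upwards [hO.mem_nhds hx] with y hy
    exact indicator_of_mem hy _
  rw [this.fderiv_eq]

theorem pd_indicator_notMem {n : ℕ} {Ω : Set (EuclideanSpace ℝ (Fin n))}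
    {F : EuclideanSpace ℝ (Fin n) → ℝ} (hs : tsupport (Ω.indicator F) ⊆ Ω)
    (i : Fin n) {x : EuclideanSpace ℝ (Fin n)} (hx : x ∉ Ω) :
    pd i (Ω.indicator F) x = 0 := by
  unfold pd
  have : x ∉ tsupport (Ω.indicator F) := fun h => hx (hs h)
  have h0 : Ω.indicator F =ᶠ[𝓝 x] fun _ => 0 := notMem_tsupport_iff_eventuallyEq.1 this
  rw [h0.fderiv_eq]; simp

theorem pd_mul {n : ℕ} (i : Fin n) {f g : EuclideanSpace ℝ (Fin n) → ℝ}
    {x : EuclideanSpace ℝ (Fin n)} (hf : DifferentiableAt ℝ f x) (hg : DifferentiableAt ℝ g x) :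
    pd i (fun y => f y * g y) x = f x * pd i g x + g x * pd i f x := by
  unfold pd
  rw [fderiv_fun_mul hf hg]; simp

theorem pd_comp {n : ℕ} (i : Fin n) {f : EuclideanSpace ℝ (Fin n) → ℝ} {η : ℝ → ℝ} {d : ℝ}
    {x : EuclideanSpace ℝ (Fin n)} (hf : DifferentiableAt ℝ f x) (hη : HasDerivAt η d (f x)) :
    pd i (fun y => η (f y)) x = d * pd i f x := by
  unfold pd
  have := (hη.comp_hasFDerivAt x hf.hasFDerivAt).fderiv
  rw [show (fun y => η (f y)) = η ∘ f from rfl, this]; simp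

/-- Primitive vanishing at zero. -/
def prim (k : ℝ → ℝ) (t : ℝ) : ℝ := ∫ s in (0:ℝ)..t, k s

theorem prim_hasDerivAt {D : Set ℝ} (hD : IsOpen D) (hc : D.OrdConnected) (h0 : (0:ℝ) ∈ D)
    {k : ℝ → ℝ} (hk : ContinuousOn k D) {t : ℝ} (ht : t ∈ D) : HasDerivAt (prim k) (k t) t := by
  have hsub : uIcc 0 t ⊆ D := hc.uIcc_subset h0 ht
  refine intervalIntegral.integral_hasDerivAt_right
    ((hk.mono hsub).intervalIntegrable) ?_ (hk.continuousAt (hD.mem_nhds ht))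
  exact hk.stronglyMeasurableAtFilter hD t ht

theorem prim_contDiffOn {D : Set ℝ} (hD : IsOpen D) (hc : D.OrdConnected) (h0 : (0:ℝ) ∈ D)
    {k : ℝ → ℝ} (hk : ContDiffOn ℝ (⊤ : ℕ∞) k D) : ContDiffOn ℝ (⊤ : ℕ∞) (prim k) D := by
  have hd : ∀ t ∈ D, HasDerivAt (prim k) (k t) t := fun t ht =>
    prim_hasDerivAt hD hc h0 hk.continuousOn ht
  rw [contDiffOn_infty_iff_deriv_of_isOpen hD]
  exact ⟨fun t ht => (hd t ht).differentiableAt.differentiableWithinAt,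
    hk.congr fun t ht => (hd t ht).deriv⟩

theorem prim_eq_zero {k : ℝ → ℝ} {ε : ℝ} (hε : 0 < ε) (hk : ∀ t, t < ε → k t = 0) {t : ℝ}
    (ht : t < ε) : prim k t = 0 := by
  unfold prim
  rw [intervalIntegral.integral_congr (g := fun _ => 0)]
  · simp
  · intro s hs
    apply hk
    rcases le_total 0 t with h | h
    · rw [uIcc_of_le h] at hs; exact hs.2.trans_lt ht
    · rw [uIcc_of_ge h] at hs; exact hs.2.trans_lt hε

theorem prim_nonneg {k : ℝ → ℝ} {t : ℝ} (ht : 0 ≤ t) (hk : ∀ s, 0 ≤ s → s ≤ t → 0 ≤ k s) :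
    0 ≤ prim k t :=
  intervalIntegral.integral_nonneg ht fun s hs => hk s hs.1 hs.2

theorem prim_le {D : Set ℝ} (hD : IsOpen D) (hc : D.OrdConnected) (h0 : (0:ℝ) ∈ D)
    {k η κ : ℝ → ℝ} (hk : ContinuousOn k D) (hη : ContinuousOn η (D ∩ Ici 0))
    (hη' : ∀ t ∈ D, 0 < t → HasDerivAt η (κ t) t) (hη0 : η 0 = 0)
    (hle : ∀ t ∈ D, 0 < t → k t ≤ κ t) {t : ℝ} (ht : t ∈ D) (ht0 : 0 ≤ t) : prim k t ≤ η t := by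
  have hsub : Icc 0 t ⊆ D := hc.out h0 ht
  have hd : ∀ s ∈ Ioo 0 t, HasDerivAt (fun s => η s - prim k s) (κ s - k s) s := fun s hs =>
    (hη' s (hsub ⟨hs.1.le, hs.2.le⟩) hs.1).sub
      (prim_hasDerivAt hD hc h0 hk (hsub ⟨hs.1.le, hs.2.le⟩))
  have hm : MonotoneOn (fun s => η s - prim k s) (Icc 0 t) := by
    refine monotoneOn_of_deriv_nonneg (convex_Icc 0 t) ?_ ?_ ?_
    · refine (hη.mono fun s hs => ⟨hsub hs, hs.1⟩).sub fun s hs => ?_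
      exact (prim_hasDerivAt hD hc h0 hk (hsub hs)).continuousAt.continuousWithinAt
    · rw [interior_Icc]
      exact fun s hs => (hd s hs).differentiableAt.differentiableWithinAt
    · rw [interior_Icc]
      intro s hs
      rw [(hd s hs).deriv]
      linarith [hle s (hsub ⟨hs.1.le, hs.2.le⟩) hs.1]
  have := hm (left_mem_Icc.2 ht0) (right_mem_Icc.2 ht0) ht0
  simp only [hη0, prim, intervalIntegral.integral_same, sub_zero] at this
  unfold prim
  linarith

/-- Smooth cutoff, zero below `ε`, one above `2ε`. -/
def chi (ε s : ℝ) : ℝ := Real.smoothTransition ((s - ε) / ε)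

theorem chi_smooth (ε : ℝ) : ContDiff ℝ (⊤ : ℕ∞) (chi ε) := by
  unfold chi
  exact Real.smoothTransition.contDiff.comp ((contDiff_id.sub contDiff_const).div_const _)

theorem chi_nonneg (ε s : ℝ) : 0 ≤ chi ε s := Real.smoothTransition.nonneg _
theorem chi_le_one (ε s : ℝ) : chi ε s ≤ 1 := Real.smoothTransition.le_one _
theorem chi_zero {ε s : ℝ} (hε : 0 < ε) (h : s < ε) : chi ε s = 0 :=
  Real.smoothTransition.zero_of_nonpos (div_nonpos_of_nonpos_of_nonneg (by linarith) hε.le)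
theorem chi_one {ε s : ℝ} (hε : 0 < ε) (h : 2 * ε ≤ s) : chi ε s = 1 :=
  Real.smoothTransition.one_of_one_le (by rw [le_div_iff₀ hε]; linarith)
theorem chi_mono {ε : ℝ} (hε : 0 < ε) : Monotone (chi ε) := fun s t h =>
  Real.smoothTransition.monotone (by gcongr)

theorem chi_mul_smooth {D : Set ℝ} (hD : IsOpen D) {κ : ℝ → ℝ} {ε : ℝ} (hε : 0 < ε)
    (hκ : ContDiffOn ℝ (⊤ : ℕ∞) κ (D ∩ Ioi 0)) :
    ContDiffOn ℝ (⊤ : ℕ∞) (fun s => chi ε s * κ s) D := by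
  intro t ht
  apply ContDiffAt.contDiffWithinAt
  by_cases h : 0 < t
  · exact (chi_smooth ε).contDiffAt.mul
      ((hκ t ⟨ht, h⟩).contDiffAt ((hD.inter isOpen_Ioi).mem_nhds ⟨ht, h⟩))
  · have : (fun s => chi ε s * κ s) =ᶠ[𝓝 t] fun _ => 0 := by
      filter_upwards [Iio_mem_nhds (show t < ε by linarith)] with s hs
      rw [chi_zero hε hs, zero_mul]
    exact contDiffAt_const.congr_of_eventuallyEq this

theorem prim_chi_ge {D : Set ℝ} (hD : IsOpen D) (hc : D.OrdConnected) (h0 : (0:ℝ) ∈ D)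
    {η κ : ℝ → ℝ} {ε : ℝ} (hε : 0 < ε) (hεD : 2 * ε ∈ D)
    (hκ : ContDiffOn ℝ (⊤ : ℕ∞) κ (D ∩ Ioi 0)) (hη : ContinuousOn η (D ∩ Ici 0))
    (hη' : ∀ t ∈ D, 0 < t → HasDerivAt η (κ t) t)
    (hκ0 : ∀ t ∈ D, 0 < t → 0 ≤ κ t) {t : ℝ} (ht : t ∈ D) (ht0 : 0 ≤ t) :
    η t - η (2 * ε) ≤ prim (fun s => chi ε s * κ s) t := by
  have hks := chi_mul_smooth hD hε hκ
  have hsub : Icc 0 t ⊆ D := hc.out h0 ht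
  have hk0 : ∀ s, 0 ≤ s → s ∈ D → 0 ≤ chi ε s * κ s := by
    intro s hs hsD
    rcases hs.eq_or_lt with h | h
    · rw [← h, chi_zero hε hε, zero_mul]
    · exact mul_nonneg (chi_nonneg _ _) (hκ0 s hsD h)
  have hpos : ∀ s, 0 ≤ s → s ∈ D → 0 ≤ prim (fun s => chi ε s * κ s) s := fun s hs hsD =>
    prim_nonneg hs fun r hr hrs => hk0 r hr (hc.out h0 hsD ⟨hr, hrs⟩)
  rcases le_total t (2 * ε) with h | h
  · have hsub2 : Icc 0 (2 * ε) ⊆ D := hc.out h0 hεD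
    have hm : MonotoneOn η (Icc 0 (2 * ε)) := by
      refine monotoneOn_of_deriv_nonneg (convex_Icc _ _)
        (hη.mono fun s hs => ⟨hsub2 hs, hs.1⟩) ?_ ?_
      · rw [interior_Icc]
        exact fun s hs => (hη' s (hsub2 ⟨hs.1.le, hs.2.le⟩)
          hs.1).differentiableAt.differentiableWithinAt
      · rw [interior_Icc]
        intro s hs
        rw [(hη' s (hsub2 ⟨hs.1.le, hs.2.le⟩) hs.1).deriv]
        exact hκ0 s (hsub2 ⟨hs.1.le, hs.2.le⟩) hs.1
    have := hm ⟨ht0, h⟩ (right_mem_Icc.2 (by linarith)) h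
    linarith [hpos t ht0 ht]
  · have hsub3 : ∀ s ∈ Icc (2 * ε) t, s ∈ D ∧ 0 < s := fun s hs =>
      ⟨hc.out hεD ht hs, by linarith [hs.1]⟩
    have hd : ∀ s ∈ Icc (2 * ε) t, HasDerivAt
        (fun s => prim (fun s => chi ε s * κ s) s - η s) 0 s := fun s hs => by
      have h1 := (prim_hasDerivAt hD hc h0 hks.continuousOn (hsub3 s hs).1).sub
        (hη' s (hsub3 s hs).1 (hsub3 s hs).2)
      simp only [chi_one hε hs.1, one_mul, sub_self] at h1
      exact h1
    have hconst := constant_of_has_deriv_right_zero (f :=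
        (fun s => prim (fun s => chi ε s * κ s) s - η s)) (a := 2 * ε) (b := t)
      (fun s hs => (hd s hs).continuousAt.continuousWithinAt)
      (fun s hs => (hd s ⟨hs.1, hs.2.le⟩).hasDerivWithinAt) t (right_mem_Icc.2 h)
    linarith [hpos (2 * ε) (by linarith) hεD]

/-- truncated energy identity -/
theorem energy_trunc {n : ℕ} {Ω : Set (EuclideanSpace ℝ (Fin n))} (hO : IsOpen Ω)
    (hB : Bornology.IsBounded Ω) {w : EuclideanSpace ℝ (Fin n) → ℝ}
    (hw : ContDiff ℝ (⊤ : ℕ∞) w) (hw0 : ∀ x ∈ frontier Ω, w x = 0)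
    {D : Set ℝ} (hD : IsOpen D) (hc : D.OrdConnected) (h0 : (0:ℝ) ∈ D) (hwD : ∀ x ∈ Ω, w x ∈ D)
    {k : ℝ → ℝ} {ε : ℝ} (hε : 0 < ε) (hk : ContDiffOn ℝ (⊤ : ℕ∞) k D)
    (hk0 : ∀ t, t < ε → k t = 0) :
    ContDiff ℝ (⊤ : ℕ∞) (Ω.indicator fun x => prim k (w x)) ∧
    HasCompactSupport (Ω.indicator fun x => prim k (w x)) ∧
    tsupport (Ω.indicator fun x => prim k (w x)) ⊆ Ω ∧
    ∫ x in Ω, ‖gradient (Ω.indicator fun x => prim k (w x)) x‖ ^ 2 =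
      ∫ x in Ω, prim (fun s => k s ^ 2) (w x) * (- lap w x) := by
  have hk2 : ContDiffOn ℝ (⊤ : ℕ∞) (fun s => k s ^ 2) D := hk.pow 2
  have hk20 : ∀ t, t < ε → (fun s => k s ^ 2) t = 0 := fun t ht => by simp [hk0 t ht]
  have e1 := ext_zero (F := fun x => prim k (w x)) hO hB hw.continuous hw0 hε
    ((prim_contDiffOn hD hc h0 hk).comp hw.contDiffOn hwD)
    (fun x _ hx => prim_eq_zero hε hk0 hx)
  have e2 := ext_zero (F := fun x => prim (fun s => k s ^ 2) (w x)) hO hB hw.continuous hw0 hε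
    ((prim_contDiffOn hD hc h0 hk2).comp hw.contDiffOn hwD)
    (fun x _ hx => prim_eq_zero hε hk20 hx)
  refine ⟨e1.1, e1.2.1, e1.2.2, ?_⟩
  have key := ibp e2.1 e2.2.1 hw
  have hwd : Differentiable ℝ w := hw.differentiable (by simp)
  have l1 : ∫ x, (Ω.indicator fun x => prim (fun s => k s ^ 2) (w x)) x * lap w x
      = ∫ x in Ω, prim (fun s => k s ^ 2) (w x) * lap w x := by
    rw [← integral_indicator hO.measurableSet]
    congr 1; ext x
    by_cases hx : x ∈ Ω <;> simp [hx]
  have l2 : ∫ x, ∑ i, pd i (Ω.indicator fun x => prim (fun s => k s ^ 2) (w x)) x * pd i w x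
      = ∫ x in Ω, ‖gradient (Ω.indicator fun x => prim k (w x)) x‖ ^ 2 := by
    rw [← integral_indicator hO.measurableSet]
    congr 1; ext x
    by_cases hx : x ∈ Ω
    · rw [indicator_of_mem hx, norm_gradient_sq]
      refine Finset.sum_congr rfl fun i _ => ?_
      rw [pd_indicator_mem hO _ i hx, pd_indicator_mem hO _ i hx,
        pd_comp i (hwd x) (prim_hasDerivAt hD hc h0 hk2.continuousOn (hwD x hx)),
        pd_comp i (hwd x) (prim_hasDerivAt hD hc h0 hk.continuousOn (hwD x hx))]
      ring
    · rw [indicator_of_notMem hx]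
      refine Finset.sum_eq_zero fun i _ => ?_
      rw [pd_indicator_notMem e2.2.2 i hx, zero_mul]
  rw [l1, l2] at key
  simp only [mul_neg, integral_neg]
  linarith

/-- truncated Kato inequality -/
theorem kato_trunc {n : ℕ} {Ω : Set (EuclideanSpace ℝ (Fin n))} (hO : IsOpen Ω)
    (hB : Bornology.IsBounded Ω) {w g : EuclideanSpace ℝ (Fin n) → ℝ}
    (hw : ContDiff ℝ (⊤ : ℕ∞) w) (hw0 : ∀ x ∈ frontier Ω, w x = 0)
    (hg : ContDiff ℝ (⊤ : ℕ∞) g) (hg0 : ∀ x, 0 ≤ g x)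
    {ε : ℝ} (hε : 0 < ε) :
    ∫ x in Ω, g x * chi ε (w x) * lap w x ≤ ∫ x in Ω, prim (chi ε) (w x) * lap g x := by
  have hk := (chi_smooth ε)
  have hk0 : ∀ t, t < ε → chi ε t = 0 := fun t ht => chi_zero hε ht
  have hKD := fun t => prim_hasDerivAt isOpen_univ ordConnected_univ (mem_univ 0)
    hk.continuous.continuousOn (mem_univ t)
  have hKs := (prim_contDiffOn isOpen_univ ordConnected_univ (mem_univ 0) hk.contDiffOn)
  have e1 := ext_zero (F := fun x => prim (chi ε) (w x)) hO hB hw.continuous hw0 hε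
    (hKs.comp hw.contDiffOn fun x _ => mem_univ _)
    (fun x _ hx => prim_eq_zero hε hk0 hx)
  have e2 := ext_zero (F := fun x => g x * chi ε (w x)) hO hB hw.continuous hw0 hε
    (hg.mul (hk.comp hw)).contDiffOn
    (fun x _ hx => by rw [hk0 _ hx, mul_zero])
  have k1 := ibp e1.1 e1.2.1 hg
  have k2 := ibp e2.1 e2.2.1 hw
  have hwd : Differentiable ℝ w := hw.differentiable (by simp)
  have hgd : Differentiable ℝ g := hg.differentiable (by simp)
  have l1 : ∫ x, (Ω.indicator fun x => prim (chi ε) (w x)) x * lap g x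
      = ∫ x in Ω, prim (chi ε) (w x) * lap g x := by
    rw [← integral_indicator hO.measurableSet]
    congr 1; ext x
    by_cases hx : x ∈ Ω <;> simp [hx]
  have l2 : ∫ x, (Ω.indicator fun x => g x * chi ε (w x)) x * lap w x
      = ∫ x in Ω, g x * chi ε (w x) * lap w x := by
    rw [← integral_indicator hO.measurableSet]
    congr 1; ext x
    by_cases hx : x ∈ Ω <;> simp [hx]
  rw [← l1, ← l2, k1, k2, neg_le_neg_iff]
  refine integral_mono ?_ ?_ ?_
  · refine integrable_finsetSum _ fun i _ => ?_
    exact ((pd_smooth i e1.1).continuous.mul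
      (pd_smooth i hg).continuous).integrable_of_hasCompactSupport
      (pd_compactSupport i e1.2.1).mul_right
  · refine integrable_finsetSum _ fun i _ => ?_
    exact ((pd_smooth i e2.1).continuous.mul
      (pd_smooth i hw).continuous).integrable_of_hasCompactSupport
      (pd_compactSupport i e2.2.1).mul_right
  · intro x
    refine Finset.sum_le_sum fun i _ => ?_
    by_cases hx : x ∈ Ω
    · have hchi : HasDerivAt (chi ε) (deriv (chi ε) (w x)) (w x) :=
        ((hk.differentiable (by simp)) _).hasDerivAt
      have hcd : DifferentiableAt ℝ (fun y => chi ε (w y)) x :=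
        hchi.differentiableAt.comp x (hwd x)
      rw [pd_indicator_mem hO _ i hx, pd_indicator_mem hO _ i hx,
        pd_comp i (hwd x) (hKD _), pd_mul i (hgd x) hcd, pd_comp i (hwd x) hchi]
      have h1 : 0 ≤ deriv (chi ε) (w x) := (chi_mono hε).deriv_nonneg
      nlinarith [mul_nonneg (mul_nonneg (hg0 x) h1) (sq_nonneg (pd i w x))]
    · rw [pd_indicator_notMem e1.2.2 i hx, pd_indicator_notMem e2.2.2 i hx]; simp

theorem integrableOn_of_closure {n : ℕ} {Ω : Set (EuclideanSpace ℝ (Fin n))}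
    (hB : Bornology.IsBounded Ω) {F : EuclideanSpace ℝ (Fin n) → ℝ}
    (hF : ContinuousOn F (closure Ω)) : IntegrableOn F Ω :=
  (hF.integrableOn_compact hB.isCompact_closure).mono_set subset_closure

theorem integrableOn_of_cont {n : ℕ} {Ω : Set (EuclideanSpace ℝ (Fin n))}
    (hB : Bornology.IsBounded Ω) {F : EuclideanSpace ℝ (Fin n) → ℝ}
    (hF : Continuous F) : IntegrableOn F Ω :=
  integrableOn_of_closure hB hF.continuousOn

theorem closure_cases {n : ℕ} {Ω : Set (EuclideanSpace ℝ (Fin n))} {P : EuclideanSpace ℝ (Fin n) → Prop}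
    (hO : IsOpen Ω) (h1 : ∀ x ∈ Ω, P x) (h2 : ∀ x ∈ frontier Ω, P x) : ∀ x ∈ closure Ω, P x := by
  intro x hx
  by_cases h : x ∈ Ω
  · exact h1 x h
  · exact h2 x (by rw [hO.frontier_eq]; exact ⟨hx, h⟩)

theorem kato {n : ℕ} {Ω : Set (EuclideanSpace ℝ (Fin n))} (hO : IsOpen Ω)
    (hB : Bornology.IsBounded Ω) {w g : EuclideanSpace ℝ (Fin n) → ℝ}
    (hw : ContDiff ℝ (⊤ : ℕ∞) w) (hw0 : ∀ x ∈ frontier Ω, w x = 0)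
    (hwp : ∀ x ∈ Ω, 0 ≤ w x) (hwl : ∀ x ∈ Ω, lap w x ≤ 0)
    (hg : ContDiff ℝ (⊤ : ℕ∞) g) (hg0 : ∀ x, 0 ≤ g x) :
    ∫ x in Ω, g x * lap w x ≤ ∫ x in Ω, w x * lap g x := by
  set M := ∫ x in Ω, |lap g x| with hM
  have hM0 : 0 ≤ M := integral_nonneg fun x => abs_nonneg _
  have hgc := hg.continuous
  have hlw := (lap_smooth hw).continuous
  have hlg := (lap_smooth hg).continuous
  have hwc := hw.continuous
  have main : ∀ ε : ℝ, 0 < ε → ∫ x in Ω, g x * lap w x ≤ (∫ x in Ω, w x * lap g x) + 2 * ε * M := by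
    intro ε hε
    have hχ := (chi_smooth ε).continuous
    have hKc : Continuous (prim (chi ε)) := by
      rw [continuous_iff_continuousAt]
      exact fun t => (prim_hasDerivAt isOpen_univ ordConnected_univ (mem_univ 0)
        hχ.continuousOn (mem_univ t)).continuousAt
    have s1 : ∫ x in Ω, g x * lap w x ≤ ∫ x in Ω, g x * chi ε (w x) * lap w x := by
      refine setIntegral_mono_on (integrableOn_of_cont hB (by fun_prop))
        (integrableOn_of_cont hB (by fun_prop)) hO.measurableSet fun x hx => ?_
      have := mul_nonneg (hg0 x) (sub_nonneg.2 (chi_le_one ε (w x)))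
      nlinarith [hwl x hx]
    have s3 : ∫ x in Ω, prim (chi ε) (w x) * lap g x ≤
        ∫ x in Ω, (w x * lap g x + 2 * ε * |lap g x|) := by
      refine setIntegral_mono_on (integrableOn_of_cont hB (by fun_prop))
        (integrableOn_of_cont hB (by fun_prop)) hO.measurableSet fun x hx => ?_
      have h1 : prim (chi ε) (w x) ≤ w x := prim_le (η := fun t => t) (κ := fun _ => 1)
        isOpen_univ ordConnected_univ (mem_univ 0) hχ.continuousOn continuousOn_id
        (fun t _ _ => hasDerivAt_id t) rfl (fun t _ _ => chi_le_one ε t) (mem_univ _) (hwp x hx)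
      have h2 := prim_chi_ge (η := fun t => t) (κ := fun _ => 1)
        isOpen_univ ordConnected_univ (mem_univ 0) hε (mem_univ _) contDiffOn_const continuousOn_id
        (fun t _ _ => hasDerivAt_id t) (fun t _ _ => zero_le_one) (mem_univ (w x)) (hwp x hx)
      simp only [mul_one] at h2
      change w x - 2 * ε ≤ prim (chi ε) (w x) at h2
      have h3 : |prim (chi ε) (w x) - w x| ≤ 2 * ε := abs_le.2 ⟨by linarith, by linarith⟩
      have h4 : (prim (chi ε) (w x) - w x) * lap g x ≤ 2 * ε * |lap g x| := by
        refine (le_abs_self _).trans ?_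
        rw [abs_mul]
        gcongr
      linarith
    rw [integral_add (integrableOn_of_cont hB (by fun_prop))
      (integrableOn_of_cont hB (by fun_prop)), integral_const_mul] at s3
    exact s1.trans ((kato_trunc hO hB hw hw0 hg hg0 hε).trans s3)
  refine le_of_forall_pos_le_add fun δ hδ => ?_
  have := main (δ / (2 * (M + 1))) (by positivity)
  refine this.trans (add_le_add_right ?_ _)
  rw [show 2 * (δ / (2 * (M + 1))) * M = δ * (M / (M + 1)) by field_simp]
  have : M / (M + 1) ≤ 1 := (div_le_one (by linarith)).2 (by linarith)
  nlinarith

theorem energy {n : ℕ} {Ω : Set (EuclideanSpace ℝ (Fin n))} (hO : IsOpen Ω)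
    (hB : Bornology.IsBounded Ω) {w ρ : EuclideanSpace ℝ (Fin n) → ℝ}
    (hw : ContDiff ℝ (⊤ : ℕ∞) w) (hw0 : ∀ x ∈ frontier Ω, w x = 0)
    (hwp : ∀ x ∈ Ω, 0 ≤ w x) (hwl : ∀ x ∈ Ω, lap w x ≤ 0)
    {D : Set ℝ} (hD : IsOpen D) (hc : D.OrdConnected) (h0 : (0:ℝ) ∈ D) (hwD : ∀ x ∈ Ω, w x ∈ D)
    (hρ : ContinuousOn ρ (closure Ω)) (hρ0 : ∀ x ∈ Ω, 0 ≤ ρ x) {c : ℝ} (hc0 : 0 ≤ c)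
    (hS : ∀ φ : EuclideanSpace ℝ (Fin n) → ℝ, ContDiff ℝ (⊤ : ℕ∞) φ → HasCompactSupport φ →
      tsupport φ ⊆ Ω → c * ∫ x in Ω, ρ x * (φ x) ^ 2 ≤ ∫ x in Ω, ‖gradient φ x‖ ^ 2)
    {η κ Q : ℝ → ℝ}
    (hκ : ContDiffOn ℝ (⊤ : ℕ∞) κ (D ∩ Ioi 0)) (hη : ContinuousOn η (D ∩ Ici 0))
    (hη' : ∀ t ∈ D, 0 < t → HasDerivAt η (κ t) t) (hη0 : η 0 = 0)
    (hκ0 : ∀ t ∈ D, 0 < t → 0 ≤ κ t)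
    (hQ : ContinuousOn Q (D ∩ Ici 0))
    (hQ' : ∀ t ∈ D, 0 < t → HasDerivAt Q (κ t ^ 2) t) (hQ0 : Q 0 = 0) :
    c * ∫ x in Ω, ρ x * η (w x) ^ 2 ≤ ∫ x in Ω, Q (w x) * (- lap w x) := by
  have hwcl : ∀ x ∈ closure Ω, w x ∈ D ∩ Ici 0 :=
    closure_cases hO (fun x hx => ⟨hwD x hx, hwp x hx⟩)
      (fun x hx => by rw [hw0 x hx]; exact ⟨h0, self_mem_Ici⟩)
  have hηw : ContinuousOn (fun x => η (w x)) (closure Ω) :=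
    hη.comp hw.continuous.continuousOn hwcl
  have hQw : ContinuousOn (fun x => Q (w x)) (closure Ω) :=
    hQ.comp hw.continuous.continuousOn hwcl
  have hlw := (lap_smooth hw).continuous
  have hηnn : ∀ t ∈ D, 0 ≤ t → 0 ≤ η t := by
    intro t ht ht0
    have := prim_le (k := fun _ => 0) hD hc h0 continuousOn_const hη hη' hη0 hκ0 ht ht0
    simpa [prim] using this
  set A := ∫ x in Ω, ρ x * η (w x) ^ 2 with hA
  set B := ∫ x in Ω, ρ x * η (w x) with hBdef
  set R := ∫ x in Ω, Q (w x) * (- lap w x) with hR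
  have main : ∀ ε : ℝ, 0 < ε → 2 * ε ∈ D → c * (A - 2 * η (2 * ε) * B) ≤ R := by
    intro ε hε hεD
    set k : ℝ → ℝ := fun s => chi ε s * κ s with hk
    have hks : ContDiffOn ℝ (⊤ : ℕ∞) k D := chi_mul_smooth hD hε hκ
    have hk0 : ∀ t, t < ε → k t = 0 := fun t ht => by simp [hk, chi_zero hε ht]
    obtain ⟨t1, t2, t3, t4⟩ := energy_trunc hO hB hw hw0 hD hc h0 hwD hε hks hk0
    have hst := hS _ t1 t2 t3
    rw [t4] at hst
    have hKc : ContinuousOn (fun x => prim k (w x)) (closure Ω) := by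
      have : ContinuousOn (prim k) D := fun t ht =>
        (prim_hasDerivAt hD hc h0 hks.continuousOn ht).continuousAt.continuousWithinAt
      exact this.comp hw.continuous.continuousOn fun x hx => (hwcl x hx).1
    have hK2c : ContinuousOn (fun x => prim (fun s => k s ^ 2) (w x)) (closure Ω) := by
      have : ContinuousOn (prim (fun s => k s ^ 2)) D := fun t ht =>
        (prim_hasDerivAt hD hc h0 (hks.continuousOn.pow 2) ht).continuousAt.continuousWithinAt
      exact this.comp hw.continuous.continuousOn fun x hx => (hwcl x hx).1
    have hδ : 0 ≤ η (2 * ε) := hηnn _ hεD (by positivity)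
    have s1 : A - 2 * η (2 * ε) * B ≤
        ∫ x in Ω, ρ x * ((Ω.indicator fun x => prim k (w x)) x) ^ 2 := by
      have i1 : IntegrableOn (fun x => ρ x * η (w x) ^ 2) Ω :=
        integrableOn_of_closure hB (hρ.mul (hηw.pow 2))
      have i2 : IntegrableOn (fun x => 2 * η (2 * ε) * (ρ x * η (w x))) Ω :=
        integrableOn_of_closure hB (continuousOn_const.mul (hρ.mul hηw))
      rw [hA, hBdef, ← integral_const_mul, ← integral_sub i1 i2]
      refine setIntegral_mono_on (integrableOn_of_closure hB
        ((hρ.mul (hηw.pow 2)).sub (continuousOn_const.mul (hρ.mul hηw)))) ?_ hO.measurableSet fun x hx => ?_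
      · refine integrableOn_of_closure hB (hρ.mul (t1.continuous.pow 2).continuousOn)
      · rw [indicator_of_mem hx]
        have hge : η (w x) - η (2 * ε) ≤ prim k (w x) :=
          prim_chi_ge hD hc h0 hε hεD hκ hη hη' hκ0 (hwD x hx) (hwp x hx)
        have hnn : 0 ≤ prim k (w x) := by
          refine prim_nonneg (hwp x hx) fun s hs hsw => ?_
          rcases hs.eq_or_lt with h | h
          · rw [← h, hk0 0 hε]
          · exact mul_nonneg (chi_nonneg _ _) (hκ0 s (hc.out h0 (hwD x hx) ⟨hs, hsw⟩) h)
        have hηx := hηnn _ (hwD x hx) (hwp x hx)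
        have : η (w x) ^ 2 - 2 * η (2 * ε) * η (w x) ≤ prim k (w x) ^ 2 := by
          rcases le_total (η (2 * ε)) (η (w x)) with h | h
          · nlinarith
          · nlinarith [sq_nonneg (prim k (w x))]
        nlinarith [hρ0 x hx]
    have s2 : ∫ x in Ω, prim (fun s => k s ^ 2) (w x) * (- lap w x) ≤ R := by
      refine setIntegral_mono_on (integrableOn_of_closure hB (hK2c.mul hlw.neg.continuousOn))
        (integrableOn_of_closure hB (hQw.mul hlw.neg.continuousOn)) hO.measurableSet fun x hx => ?_
      refine mul_le_mul_of_nonneg_right ?_ (by linarith [hwl x hx])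
      refine prim_le hD hc h0 (hks.continuousOn.pow 2) hQ hQ' hQ0 (fun t ht ht0 => ?_)
        (hwD x hx) (hwp x hx)
      change (chi ε t * κ t) ^ 2 ≤ κ t ^ 2
      rw [mul_pow]
      have : chi ε t ^ 2 ≤ 1 := pow_le_one₀ (chi_nonneg _ _) (chi_le_one _ _)
      nlinarith [sq_nonneg (κ t)]
    exact (mul_le_mul_of_nonneg_left s1 hc0).trans (hst.trans s2)
  have hlim : Tendsto (fun ε : ℝ => c * (A - 2 * η (2 * ε) * B)) (𝓝[>] 0) (𝓝 (c * A)) := by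
    have h1 : Tendsto η (𝓝[D ∩ Ici 0] 0) (𝓝 0) := by
      have := hη 0 ⟨h0, self_mem_Ici⟩
      rwa [ContinuousWithinAt, hη0] at this
    have h2 : Tendsto (fun ε : ℝ => 2 * ε) (𝓝[>] 0) (𝓝[D ∩ Ici 0] 0) := by
      rw [tendsto_nhdsWithin_iff]
      have h3 : Tendsto (fun ε : ℝ => 2 * ε) (𝓝[>] 0) (𝓝 0) := by
        have : Tendsto (fun ε : ℝ => 2 * ε) (𝓝 0) (𝓝 (2 * 0)) := tendsto_id.const_mul 2
        rw [mul_zero] at this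
        exact this.mono_left nhdsWithin_le_nhds
      refine ⟨h3, ?_⟩
      filter_upwards [h3 (hD.mem_nhds h0), self_mem_nhdsWithin] with ε h4 h5
      exact ⟨h4, by simp only [mem_Ioi] at h5; simp [h5.le]⟩
    have h4 := h1.comp h2
    have := (((h4.const_mul 2).mul_const B).const_sub A).const_mul c
    simpa [Function.comp_def] using this
  refine le_of_tendsto hlim ?_
  have h3 : Tendsto (fun ε : ℝ => 2 * ε) (𝓝[>] 0) (𝓝 0) := by
    have : Tendsto (fun ε : ℝ => 2 * ε) (𝓝 0) (𝓝 (2 * 0)) := tendsto_id.const_mul 2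
    rw [mul_zero] at this
    exact this.mono_left nhdsWithin_le_nhds
  filter_upwards [h3 (hD.mem_nhds h0), self_mem_nhdsWithin] with ε h4 h5
  exact main ε h5 h4

theorem second_deriv_nonneg {g : ℝ → ℝ} {t : ℝ} (hg : ContinuousAt g t) (h : IsLocalMin g t) :
    0 ≤ deriv (deriv g) t := by
  by_contra hneg
  push Not at hneg
  have h1 := isLocalMax_of_deriv_deriv_neg hneg h.deriv_eq_zero hg
  have h2 : g =ᶠ[𝓝 t] fun _ => g t := by
    filter_upwards [h, h1] with s hs hs'
    exact le_antisymm hs' hs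
  have h3 : deriv g =ᶠ[𝓝 t] fun _ => 0 := by
    have := h2.deriv
    simpa using this
  rw [h3.deriv_eq] at hneg
  simp at hneg

theorem lap_nonneg_of_isLocalMin {n : ℕ} {w : EuclideanSpace ℝ (Fin n) → ℝ}
    (hw : ContDiff ℝ (⊤ : ℕ∞) w) {x : EuclideanSpace ℝ (Fin n)} (h : IsLocalMin w x) :
    0 ≤ lap w x := by
  rw [lap_eq_pd hw]
  refine Finset.sum_nonneg fun i _ => ?_
  set e : EuclideanSpace ℝ (Fin n) := EuclideanSpace.single i (1:ℝ)
  have key : ∀ f : EuclideanSpace ℝ (Fin n) → ℝ, ContDiff ℝ (⊤ : ℕ∞) f → ∀ t : ℝ,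
      HasDerivAt (fun s : ℝ => f (x + s • e)) (pd i f (x + t • e)) t := by
    intro f hf t
    have h1 : HasDerivAt (fun s : ℝ => x + s • e) e t := by
      simpa using ((hasDerivAt_id t).smul_const e).const_add x
    exact ((hf.differentiable (by simp)) _).hasFDerivAt.comp_hasDerivAt t h1
  have hd1 : deriv (fun s : ℝ => w (x + s • e)) = fun t => pd i w (x + t • e) :=
    funext fun t => (key w hw t).deriv
  have hd2 : deriv (deriv (fun s : ℝ => w (x + s • e))) 0 = pd i (pd i w) x := by
    rw [hd1, (key _ (pd_smooth i hw) 0).deriv]; simp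
  rw [← hd2]
  refine second_deriv_nonneg (key w hw 0).continuousAt ?_
  have hc : ContinuousAt (fun s : ℝ => x + s • e) 0 := by fun_prop
  have hx : x + (0:ℝ) • e = x := by simp
  have : Tendsto (fun s : ℝ => x + s • e) (𝓝 0) (𝓝 x) := by
    have := hc.tendsto
    rwa [hx] at this
  have h2 := this.eventually h
  filter_upwards [h2] with s hs
  simpa using hs

theorem min_principle {n : ℕ} {Ω : Set (EuclideanSpace ℝ (Fin n))} (hO : IsOpen Ω)
    (hB : Bornology.IsBounded Ω) {w : EuclideanSpace ℝ (Fin n) → ℝ}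
    (hw : ContDiff ℝ (⊤ : ℕ∞) w) (hw0 : ∀ x ∈ frontier Ω, w x = 0)
    (hwl : ∀ x ∈ Ω, lap w x < 0) : ∀ x ∈ Ω, 0 ≤ w x := by
  intro x hx
  obtain ⟨y, hy, hmin⟩ := hB.isCompact_closure.exists_isMinOn ⟨x, subset_closure hx⟩
    hw.continuous.continuousOn
  by_contra hneg
  push Not at hneg
  have hle : w y ≤ w x := hmin (subset_closure hx)
  have hyΩ : y ∈ Ω := by
    by_contra h
    have := hw0 y (by rw [hO.frontier_eq]; exact ⟨hy, h⟩)
    linarith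
  have hloc : IsLocalMin w y := by
    filter_upwards [hO.mem_nhds hyΩ] with z hz
    exact hmin (subset_closure hz)
  linarith [lap_nonneg_of_isLocalMin hw hloc, hwl y hyΩ]

/-- Working form of the hypotheses on one solution, as a system. -/
structure Sys {n : ℕ} (Ω : Set (EuclideanSpace ℝ (Fin n))) (p lam : ℝ)
    (u v : EuclideanSpace ℝ (Fin n) → ℝ) : Prop where
  hu : ContDiff ℝ (⊤ : ℕ∞) u
  hv : ContDiff ℝ (⊤ : ℕ∞) v
  u0 : ∀ x ∈ frontier Ω, u x = 0
  v0 : ∀ x ∈ frontier Ω, v x = 0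
  up : ∀ x ∈ Ω, 0 ≤ u x
  u1 : ∀ x ∈ Ω, u x < 1
  vp : ∀ x ∈ Ω, 0 ≤ v x
  lu : ∀ x, lap u x = - v x
  lv : ∀ x ∈ Ω, lap v x = - (lam * (1 - u x) ^ (-p))
  stab : ∀ φ : EuclideanSpace ℝ (Fin n) → ℝ, ContDiff ℝ (⊤ : ℕ∞) φ → HasCompactSupport φ →
      tsupport φ ⊆ Ω → (√lam * √p) * ∫ x in Ω, (1 - u x) ^ (-((p + 1) / 2)) * (φ x) ^ 2
        ≤ ∫ x in Ω, ‖gradient φ x‖ ^ 2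

theorem hasDerivAt_one_sub_rpow {t : ℝ} (ht : t < 1) (r : ℝ) :
    HasDerivAt (fun s : ℝ => (1 - s) ^ r) (-r * (1 - t) ^ (r - 1)) t := by
  have h1 : HasDerivAt (fun s : ℝ => 1 - s) (-1) t := by
    simpa using (hasDerivAt_id t).const_sub 1
  have := h1.rpow_const (p := r) (Or.inl (by linarith))
  convert! this using 1
  ring

theorem lap_neg {n : ℕ} {u : EuclideanSpace ℝ (Fin n) → ℝ} (hu : ContDiff ℝ (⊤ : ℕ∞) u)
    (x : EuclideanSpace ℝ (Fin n)) : lap (fun y => - u y) x = - lap u x := by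
  have key : ∀ i : Fin n, ∀ f : EuclideanSpace ℝ (Fin n) → ℝ,
      pd i (fun y => - f y) = fun y => - pd i f y := by
    intro i f; ext y
    unfold pd
    rw [fderiv_fun_neg]; rfl
  rw [lap_eq_pd hu, lap_eq_pd hu.neg, ← Finset.sum_neg_distrib]
  refine Finset.sum_congr rfl fun i _ => ?_
  rw [key, key]

theorem sys_of {n : ℕ} {Ω : Set (EuclideanSpace ℝ (Fin n))} (hΩ : GoodDomain Ω)
    {p : ℝ} (hp : 1 < p) {lam : ℝ} (hlam : 0 < lam) {u : EuclideanSpace ℝ (Fin n) → ℝ}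
    (hsol : Solves Ω (1 : EReal) lam (fun t => (1 - t) ^ (-p)) u)
    (hstab : StabIneq Ω lam (fun t => (1 - t) ^ (-p)) u) :
    Sys Ω p lam u (fun x => - lap u x) := by
  obtain ⟨h1, h2, h3, h4, h5⟩ := hsol
  have hlt : ∀ x ∈ Ω, u x < 1 := fun x hx => by
    have := (h2 x hx).2
    exact_mod_cast this
  have hlv : ∀ x ∈ Ω, lap (fun x => - lap u x) x = - (lam * (1 - u x) ^ (-p)) := by
    intro x hx
    rw [lap_neg (lap_smooth h1), h3 x hx]
  have hv0 : ∀ x ∈ frontier Ω, (fun x => - lap u x) x = 0 := fun x hx => by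
    simp [h5 x hx]
  refine ⟨h1, (lap_smooth h1).neg, h4, hv0, fun x hx => (h2 x hx).1, hlt, ?_, ?_, hlv, ?_⟩
  · refine min_principle hΩ.1 hΩ.2.1 (lap_smooth h1).neg hv0 fun x hx => ?_
    rw [hlv x hx, neg_neg_iff_pos]
    exact mul_pos hlam (rpow_pos_of_pos (by linarith [hlt x hx]) _)
  · intro x; ring
  · intro φ hφ hc hs
    have := hstab φ hφ hc hs
    refine le_trans (le_of_eq ?_) this
    rw [mul_assoc, ← integral_const_mul]
    congr 1
    refine setIntegral_congr_fun hΩ.1.measurableSet fun x hx => ?_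
    have hh : 0 < 1 - u x := by linarith [hlt x hx]
    have hd : deriv (fun t : ℝ => (1 - t) ^ (-p)) (u x) = p * (1 - u x) ^ (-(p + 1)) := by
      rw [(hasDerivAt_one_sub_rpow (hlt x hx) (-p)).deriv]
      congr 1
      · ring
      · congr 1; ring
    rw [hd, Real.sqrt_mul (by linarith), Real.sqrt_eq_rpow ((1 - u x) ^ _), ← rpow_mul hh.le]
    rw [show -(p + 1) * (1 / 2) = -((p + 1) / 2) by ring]
    ring

theorem energy_u {n : ℕ} {Ω : Set (EuclideanSpace ℝ (Fin n))} (hΩ : GoodDomain Ω)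
    {p lam : ℝ} {u v : EuclideanSpace ℝ (Fin n) → ℝ} (S : Sys Ω p lam u v) {a : ℝ} (ha : 0 < a) :
    (√lam * √p) * ∫ x in Ω, (1 - u x) ^ (-((p + 1) / 2)) * ((1 - u x) ^ (-a) - 1) ^ 2 ≤
      ∫ x in Ω, (a ^ 2 / (2 * a + 1) * ((1 - u x) ^ (-(2 * a + 1)) - 1)) * v x := by
  have hcl : ∀ x ∈ closure Ω, u x < 1 := closure_cases hΩ.1 S.u1
    (fun x hx => by rw [S.u0 x hx]; exact one_pos)
  have hcont : ∀ r : ℝ, ContinuousOn (fun t : ℝ => (1 - t) ^ r) (Iio 1) := fun r t ht =>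
    (hasDerivAt_one_sub_rpow ht r).continuousAt.continuousWithinAt
  have := energy (D := Iio 1) (ρ := fun x => (1 - u x) ^ (-((p + 1) / 2)))
    (η := fun t => (1 - t) ^ (-a) - 1) (κ := fun t => a * (1 - t) ^ (-a - 1))
    (Q := fun t => a ^ 2 / (2 * a + 1) * ((1 - t) ^ (-(2 * a + 1)) - 1))
    hΩ.1 hΩ.2.1 S.hu S.u0 S.up (fun x hx => by rw [S.lu]; linarith [S.vp x hx]) isOpen_Iio
    ordConnected_Iio (by simp) S.u1 ((hcont _).comp S.hu.continuous.continuousOn hcl)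
    (fun x hx => rpow_nonneg (by linarith [S.u1 x hx]) _) (by positivity) S.stab
    ?_ ?_ ?_ (by simp) ?_ ?_ ?_ (by simp)
  · simpa only [S.lu, neg_neg] using this
  · intro t ht
    refine ContDiffAt.contDiffWithinAt ?_
    refine contDiffAt_const.mul ?_
    exact (contDiffAt_const.sub contDiffAt_id).rpow_const_of_ne
      (by have : t < 1 := ht.1; simp only [id]; linarith)
  · exact ((hcont _).sub continuousOn_const).mono inter_subset_left
  · intro t ht _
    convert! (hasDerivAt_one_sub_rpow ht (-a)).sub_const 1 using 1
    ring
  · intro t ht _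
    exact mul_nonneg ha.le (rpow_nonneg (by have : t < 1 := ht; linarith) _)
  · exact (continuousOn_const.mul ((hcont _).sub continuousOn_const)).mono inter_subset_left
  · intro t ht _
    have hpos : 0 < 1 - t := by have : t < 1 := ht; linarith
    convert! ((hasDerivAt_one_sub_rpow ht (-(2 * a + 1))).sub_const 1).const_mul
      (a ^ 2 / (2 * a + 1)) using 1
    rw [mul_pow, ← rpow_natCast ((1 - t) ^ _), ← rpow_mul hpos.le]
    rw [show (-a - 1) * ((2:ℕ):ℝ) = -(2 * a + 1) - 1 by push_cast; ring]
    field_simp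

theorem energy_v {n : ℕ} {Ω : Set (EuclideanSpace ℝ (Fin n))} (hΩ : GoodDomain Ω)
    {p lam : ℝ} (hlam : 0 < lam)
    {u v : EuclideanSpace ℝ (Fin n) → ℝ} (S : Sys Ω p lam u v) {b : ℝ} (hb : 1 ≤ b) :
    (√lam * √p) * ∫ x in Ω, (1 - u x) ^ (-((p + 1) / 2)) * (v x ^ b) ^ 2 ≤
      ∫ x in Ω, (b ^ 2 / (2 * b - 1) * v x ^ (2 * b - 1)) * (lam * (1 - u x) ^ (-p)) := by
  have hcl : ∀ x ∈ closure Ω, u x < 1 := closure_cases hΩ.1 S.u1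
    (fun x hx => by rw [S.u0 x hx]; exact one_pos)
  have hcont : ∀ r : ℝ, ContinuousOn (fun t : ℝ => (1 - t) ^ r) (Iio 1) := fun r t ht =>
    (hasDerivAt_one_sub_rpow ht r).continuousAt.continuousWithinAt
  have := energy (D := univ) (w := v) (ρ := fun x => (1 - u x) ^ (-((p + 1) / 2)))
    (η := fun t => t ^ b) (κ := fun t => b * t ^ (b - 1))
    (Q := fun t => b ^ 2 / (2 * b - 1) * t ^ (2 * b - 1))
    hΩ.1 hΩ.2.1 S.hv S.v0 S.vp (fun x hx => by
      rw [S.lv x hx, neg_nonpos]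
      exact mul_nonneg hlam.le (rpow_nonneg (by linarith [S.u1 x hx]) _)) isOpen_univ
    ordConnected_univ (by simp) (by simp) ((hcont _).comp S.hu.continuous.continuousOn hcl)
    (fun x hx => rpow_nonneg (by linarith [S.u1 x hx]) _) (by positivity) S.stab
    ?_ ?_ ?_ ?_ ?_ ?_ ?_ ?_
  · refine this.trans (le_of_eq ?_)
    refine setIntegral_congr_fun hΩ.1.measurableSet fun x hx => ?_
    rw [S.lv x hx, neg_neg]
  · intro t ht
    have : 0 < t := ht.2
    refine ContDiffAt.contDiffWithinAt ?_
    exact contDiffAt_const.mul (contDiffAt_id.rpow_const_of_ne this.ne')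
  · exact (continuous_id.rpow_const fun x => Or.inr (by linarith)).continuousOn
  · intro t _ ht
    exact Real.hasDerivAt_rpow_const (Or.inl ht.ne')
  · exact zero_rpow (by linarith)
  · intro t _ ht
    positivity
  · exact (continuous_const.mul (continuous_id.rpow_const fun x => Or.inr (by linarith))).continuousOn
  · intro t _ ht
    convert! (Real.hasDerivAt_rpow_const (p := 2 * b - 1) (Or.inl ht.ne')).const_mul
      (b ^ 2 / (2 * b - 1)) using 1
    rw [mul_pow, ← rpow_natCast (t ^ _), ← rpow_mul ht.le]
    rw [show (b - 1) * ((2:ℕ):ℝ) = 2 * b - 1 - 1 by push_cast; ring]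
    have : 2 * b - 1 ≠ 0 := by linarith
    have h5 : b * 2 - 1 ≠ 0 := by linarith
    field_simp
    try rw [div_self h5]
  · show b ^ 2 / (2 * b - 1) * (0:ℝ) ^ (2 * b - 1) = 0
    rw [zero_rpow (by linarith), mul_zero]

theorem young2b {b x y : ℝ} (hb : 1 ≤ b) (hx : 0 ≤ x) (hy : 0 ≤ y) :
    x * y ^ (2 * b - 1) ≤ 1 / (2 * b) * x ^ (2 * b) + (2 * b - 1) / (2 * b) * y ^ (2 * b) := by
  have hb0 : 0 < 2 * b := by linarith
  have h := Real.geom_mean_le_arith_mean2_weighted (w₁ := 1 / (2 * b)) (w₂ := (2 * b - 1) / (2 * b))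
    (by positivity) (div_nonneg (by linarith) hb0.le)
    (rpow_nonneg hx (2 * b)) (rpow_nonneg hy (2 * b)) (by field_simp; ring)
  rw [← rpow_mul hx, ← rpow_mul hy, mul_one_div_cancel hb0.ne', rpow_one,
    mul_div_cancel₀ _ hb0.ne'] at h
  exact h

theorem ptwise {a N q ε : ℝ} (ha : 0 < a) (hN : 0 < N) (hq : N = q + 2 * a)
    (hε : 0 < ε) {h : ℝ} (hh : 0 < h) :
    (1 - ε) * h ^ (-N) - (2 / ε) ^ (N / a) ≤ h ^ (-q) * (h ^ (-a) - 1) ^ 2 := by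
  set W := h ^ (-a) with hW
  have hWp : 0 < W := rpow_pos_of_pos hh _
  have e1 : h ^ (-N) = h ^ (-q) * W ^ 2 := by
    rw [hW, ← rpow_natCast (h ^ (-a)), ← rpow_mul hh.le, ← rpow_add hh, hq]
    congr 1; push_cast; ring
  have e2 : h ^ (-N) = W ^ (N / a) := by
    rw [hW, ← rpow_mul hh.le]
    congr 1; field_simp
  have hqp : 0 < h ^ (-q) := rpow_pos_of_pos hh _
  have hNp : 0 < h ^ (-N) := rpow_pos_of_pos hh _
  have hC : 0 ≤ (2 / ε) ^ (N / a) := by positivity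
  rcases le_total (2 / ε) W with hc | hc
  · have h3 : 2 ≤ ε * W := by rwa [div_le_iff₀' hε] at hc
    have : (1 - ε) * W ^ 2 ≤ (W - 1) ^ 2 := by nlinarith
    rw [e1]
    have := mul_le_mul_of_nonneg_left this hqp.le
    linarith
  · have : h ^ (-N) ≤ (2 / ε) ^ (N / a) := by
      rw [e2]; exact rpow_le_rpow hWp.le hc (by positivity)
    have h4 : 0 ≤ h ^ (-q) * (W - 1) ^ 2 := by positivity
    nlinarith

theorem closure_lt_one {n : ℕ} {Ω : Set (EuclideanSpace ℝ (Fin n))} (hΩ : GoodDomain Ω)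
    {p lam : ℝ} {u v : EuclideanSpace ℝ (Fin n) → ℝ} (S : Sys Ω p lam u v) :
    ∀ x ∈ closure Ω, u x < 1 := closure_cases hΩ.1 S.u1
    (fun x hx => by rw [S.u0 x hx]; exact one_pos)

theorem cont_h {n : ℕ} {Ω : Set (EuclideanSpace ℝ (Fin n))} (hΩ : GoodDomain Ω)
    {p lam : ℝ} {u v : EuclideanSpace ℝ (Fin n) → ℝ} (S : Sys Ω p lam u v) (r : ℝ) :
    ContinuousOn (fun x => (1 - u x) ^ r) (closure Ω) := by
  refine ContinuousOn.rpow_const (continuousOn_const.sub S.hu.continuous.continuousOn) ?_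
  intro x hx
  exact Or.inl (by linarith [closure_lt_one hΩ S x hx])

theorem int_est {n : ℕ} {Ω : Set (EuclideanSpace ℝ (Fin n))} (hΩ : GoodDomain Ω)
    {p lam : ℝ} (hp : 1 < p) (hlam : 0 < lam)
    {u v : EuclideanSpace ℝ (Fin n) → ℝ} (S : Sys Ω p lam u v) {a b N c1 c2 ε : ℝ} (hb : 1 ≤ b)
    (hadef : a = b * (p - 1) / 2) (hNdef : N = (p + 1) / 2 + b * (p - 1))
    (hc1 : c1 = a ^ 2 / (2 * a + 1)) (hc2 : c2 = b ^ 2 / (2 * b - 1))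
    (hε : ε = (p - c1 * c2) / (2 * p)) (hcc : c1 * c2 < p) :
    (∫ x in Ω, (1 - u x) ^ (-N)) ≤
      2 * p * ((2 / ε) ^ (N / a) * volume.real Ω) / (p - c1 * c2) ∧
    (∫ x in Ω, v x) ≤ volume.real Ω + (c2 * √lam / √p) ^ (2 * b) *
      (2 * p * ((2 / ε) ^ (N / a) * volume.real Ω) / (p - c1 * c2)) := by
  have hb0 : 0 < 2 * b := by linarith
  have hp0 : 0 < p := by linarith
  have ha : 0 < a := by rw [hadef]; have : 0 < p - 1 := by linarith
                        positivity
  have hN : 0 < N := by rw [hNdef]; have : 0 < p - 1 := by linarith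
                        positivity
  have hc1p : 0 < c1 := by rw [hc1]; positivity
  have hc2p : 0 < c2 := by rw [hc2]; exact div_pos (by positivity) (by linarith)
  have hεp : 0 < ε := by rw [hε]; exact div_pos (by linarith) (by positivity)
  have hs : 0 < √lam := Real.sqrt_pos.2 hlam
  have hr : 0 < √p := Real.sqrt_pos.2 hp0
  have hss : √lam * √lam = lam := Real.mul_self_sqrt hlam.le
  have hrr : √p * √p = p := Real.mul_self_sqrt hp0.le
  set τ := c2 * √lam / √p with hτ
  have hτp : 0 < τ := by positivity
  set C := (2 / ε) ^ (N / a) with hC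
  have hO := hΩ.1
  have hB := hΩ.2.1
  have hms := hO.measurableSet
  have hpos : ∀ x ∈ Ω, 0 < 1 - u x := fun x hx => by linarith [S.u1 x hx]
  have hle1 : ∀ x ∈ Ω, 1 - u x ≤ 1 := fun x hx => by linarith [S.up x hx]
  have hvc : ∀ r : ℝ, 0 ≤ r → ContinuousOn (fun x => v x ^ r) (closure Ω) := fun r hr =>
    (S.hv.continuous.rpow_const fun x => Or.inr hr).continuousOn
  set A := ∫ x in Ω, (1 - u x) ^ (-N) with hA
  set B := ∫ x in Ω, (1 - u x) ^ (-((p + 1) / 2)) * v x ^ (2 * b) with hBB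
  have iA : IntegrableOn (fun x => (1 - u x) ^ (-N)) Ω := integrableOn_of_closure hB (cont_h hΩ S _)
  have iB : IntegrableOn (fun x => (1 - u x) ^ (-((p + 1) / 2)) * v x ^ (2 * b)) Ω :=
    integrableOn_of_closure hB ((cont_h hΩ S _).mul (hvc _ hb0.le))
  have hzp : ∀ x ∈ Ω, ∀ k : ℝ, (1 - u x) ^ (-((p + 1) / 2)) * ((1 - u x) ^ (-((p - 1) / 2))) ^ k
      = (1 - u x) ^ (-((p + 1) / 2) - (p - 1) / 2 * k) := fun x hx k => by
    rw [← rpow_mul (hpos x hx).le, ← rpow_add (hpos x hx)]; congr 1; ring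
  have hA0 : 0 ≤ A := setIntegral_nonneg hms fun x hx => rpow_nonneg (hpos x hx).le _
  have hvol : 0 ≤ volume.real Ω := measureReal_nonneg
  -- first Young inequality
  have hB1 : B ≤ τ ^ (2 * b) * A := by
    have hE := energy_v hΩ hlam S hb
    have e1 : (∫ x in Ω, (1 - u x) ^ (-((p + 1) / 2)) * (v x ^ b) ^ 2) = B := by
      refine setIntegral_congr_fun hms fun x hx => ?_
      rw [← rpow_natCast (v x ^ b), ← rpow_mul (S.vp x hx)]
      congr 2; push_cast; ring
    have e2 : (∫ x in Ω, (b ^ 2 / (2 * b - 1) * v x ^ (2 * b - 1)) * (lam * (1 - u x) ^ (-p)))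
        ≤ (√lam * √p) * (1 / (2 * b) * (τ ^ (2 * b) * A) + (2 * b - 1) / (2 * b) * B) := by
      rw [hA, hBB, ← integral_const_mul, ← integral_const_mul, ← integral_const_mul,
        ← integral_add ((iA.const_mul _).const_mul _) (iB.const_mul _), ← integral_const_mul]
      refine setIntegral_mono_on ?_ ((((iA.const_mul _).const_mul _).add (iB.const_mul _)).const_mul _)
        hms fun x hx => ?_
      · exact integrableOn_of_closure hB ((continuousOn_const.mul (hvc _ (by linarith))).mul
          (continuousOn_const.mul (cont_h hΩ S _)))
      · have hy := young2b hb (x := τ * (1 - u x) ^ (-((p - 1) / 2))) (y := v x)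
          (by have := rpow_nonneg (hpos x hx).le (-((p - 1) / 2)); positivity) (S.vp x hx)
        rw [mul_rpow hτp.le (rpow_nonneg (hpos x hx).le _)] at hy
        have h1 := hzp x hx 1
        have h2 := hzp x hx (2 * b)
        rw [rpow_one, show -((p + 1) / 2) - (p - 1) / 2 * 1 = -p by ring] at h1
        rw [show -((p + 1) / 2) - (p - 1) / 2 * (2 * b) = -N by rw [hNdef]; ring] at h2
        have hy2 := mul_le_mul_of_nonneg_left hy
          (mul_nonneg (mul_pos hs hr).le (rpow_nonneg (hpos x hx).le (-((p + 1) / 2))))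
        rw [← hc2, ← h1, ← h2]
        have h3 : √lam * √p * τ = c2 * lam := by
          rw [hτ]; field_simp; rw [pow_two, hss]
        calc _ = (√lam * √p * τ) * (1 - u x) ^ (-((p + 1) / 2)) * (1 - u x) ^ (-((p - 1) / 2))
              * v x ^ (2 * b - 1) := by rw [h3]; ring
          _ = _ := by ring
          _ ≤ _ := hy2
          _ = _ := by ring
    rw [e1] at hE
    have h4 := le_of_mul_le_mul_left (hE.trans e2) (mul_pos hs hr)
    have h5 : (2 * b - 1) / (2 * b) = 1 - 1 / (2 * b) := by field_simp
    rw [h5] at h4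
    have h6 : 1 / (2 * b) * B ≤ 1 / (2 * b) * (τ ^ (2 * b) * A) := by linarith
    exact le_of_mul_le_mul_left h6 (by positivity)
  have hmain : √lam * √p * ((1 - ε) * A - C * volume.real Ω) ≤ c1 * (τ * A) := by
    have hE := energy_u hΩ S ha
    have iE1 : IntegrableOn (fun x => (1 - u x) ^ (-((p + 1) / 2)) * ((1 - u x) ^ (-a) - 1) ^ 2) Ω :=
      integrableOn_of_closure hB ((cont_h hΩ S _).mul (((cont_h hΩ S _).sub continuousOn_const).pow 2))
    have iE2 : IntegrableOn (fun x => (a ^ 2 / (2 * a + 1) * ((1 - u x) ^ (-(2 * a + 1)) - 1)) * v x) Ω :=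
      integrableOn_of_closure hB ((continuousOn_const.mul ((cont_h hΩ S _).sub continuousOn_const)).mul
        S.hv.continuous.continuousOn)
    have iC : IntegrableOn (fun _ : EuclideanSpace ℝ (Fin n) => C) Ω :=
      integrableOn_of_cont hB continuous_const
    have e1 : (1 - ε) * A - C * volume.real Ω ≤
        ∫ x in Ω, (1 - u x) ^ (-((p + 1) / 2)) * ((1 - u x) ^ (-a) - 1) ^ 2 := by
      have : ∫ x in Ω, ((1 - ε) * (1 - u x) ^ (-N) - C) = (1 - ε) * A - C * volume.real Ω := by
        rw [integral_sub (iA.const_mul _) iC, integral_const_mul, setIntegral_const, smul_eq_mul]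
        ring
      rw [← this]
      refine setIntegral_mono_on ((iA.const_mul _).sub iC) iE1 hms fun x hx => ?_
      exact ptwise ha hN (by rw [hNdef, hadef]; ring) hεp (hpos x hx)
    have hτb : 0 < τ ^ (2 * b - 1) := rpow_pos_of_pos hτp _
    have e2 : τ ^ (2 * b - 1) * (∫ x in Ω, (a ^ 2 / (2 * a + 1) * ((1 - u x) ^ (-(2 * a + 1)) - 1)) * v x)
        ≤ c1 * (1 / (2 * b) * B + (2 * b - 1) / (2 * b) * (τ ^ (2 * b) * A)) := by
      rw [hA, hBB, ← integral_const_mul, ← integral_const_mul, ← integral_const_mul,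
        ← integral_const_mul,
        ← integral_add (iB.const_mul _) ((iA.const_mul _).const_mul _), ← integral_const_mul]
      refine setIntegral_mono_on (iE2.const_mul _)
        (((iB.const_mul _).add ((iA.const_mul _).const_mul _)).const_mul _) hms fun x hx => ?_
      have hz := rpow_nonneg (hpos x hx).le (-((p - 1) / 2))
      have hy := young2b hb (y := τ * (1 - u x) ^ (-((p - 1) / 2))) (x := v x) (S.vp x hx)
          (by positivity)
      rw [mul_rpow hτp.le hz, mul_rpow hτp.le hz] at hy
      have h1 := hzp x hx (2 * b - 1)
      have h2 := hzp x hx (2 * b)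
      rw [show -((p + 1) / 2) - (p - 1) / 2 * (2 * b - 1) = -(2 * a + 1) by rw [hadef]; ring] at h1
      rw [show -((p + 1) / 2) - (p - 1) / 2 * (2 * b) = -N by rw [hNdef]; ring] at h2
      have hy2 := mul_le_mul_of_nonneg_left hy
          (mul_nonneg hc1p.le (rpow_nonneg (hpos x hx).le (-((p + 1) / 2))))
      rw [← hc1]
      have h3 : 0 ≤ τ ^ (2 * b - 1) * c1 * v x := by have := S.vp x hx; positivity
      calc _ = τ ^ (2 * b - 1) * c1 * v x * (1 - u x) ^ (-(2 * a + 1)) - τ ^ (2 * b - 1) * c1 * v x := by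
            ring
        _ ≤ τ ^ (2 * b - 1) * c1 * v x * (1 - u x) ^ (-(2 * a + 1)) := by linarith
        _ = c1 * (1 - u x) ^ (-((p + 1) / 2)) * (v x * (τ ^ (2 * b - 1) *
            ((1 - u x) ^ (-((p - 1) / 2))) ^ (2 * b - 1))) := by rw [← h1]; ring
        _ ≤ _ := hy2
        _ = _ := by rw [← h2]; ring
    have h5 : (2 * b - 1) / (2 * b) = 1 - 1 / (2 * b) := by field_simp
    have e3 : 1 / (2 * b) * B + (2 * b - 1) / (2 * b) * (τ ^ (2 * b) * A) ≤ τ ^ (2 * b) * A := by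
      rw [h5]
      have := mul_le_mul_of_nonneg_left hB1 (show 0 ≤ 1 / (2 * b) by positivity)
      linarith
    have e4 : τ ^ (2 * b) = τ ^ (2 * b - 1) * τ := by
      rw [← rpow_add_one hτp.ne']; congr 1; ring
    have e5 : τ ^ (2 * b - 1) * (√lam * √p * ((1 - ε) * A - C * volume.real Ω)) ≤
        τ ^ (2 * b - 1) * (c1 * (τ * A)) := by
      calc _ ≤ τ ^ (2 * b - 1) * _ := mul_le_mul_of_nonneg_left
            ((mul_le_mul_of_nonneg_left e1 (mul_pos hs hr).le).trans hE) hτb.le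
        _ ≤ _ := e2
        _ ≤ c1 * (τ ^ (2 * b) * A) := mul_le_mul_of_nonneg_left e3 hc1p.le
        _ = _ := by rw [e4]; ring
    exact le_of_mul_le_mul_left e5 hτb
  have hfin : A ≤ 2 * p * (C * volume.real Ω) / (p - c1 * c2) := by
    have h1 : p * ((1 - ε) * A - C * volume.real Ω) ≤ c1 * c2 * A := by
      have h3 : √lam * (p * ((1 - ε) * A - C * volume.real Ω)) ≤ √lam * (c1 * c2 * A) := by
        have := mul_le_mul_of_nonneg_left hmain hr.le
        calc _ = √p * (√lam * √p * ((1 - ε) * A - C * volume.real Ω)) := by linear_combination (-(√lam * ((1 - ε) * A - C * volume.real Ω))) * hrr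
          _ ≤ _ := this
          _ = _ := by rw [hτ]; field_simp
      exact le_of_mul_le_mul_left h3 hs
    have h2 : p * ε = (p - c1 * c2) / 2 := by rw [hε]; field_simp
    rw [le_div_iff₀ (by linarith)]
    nlinarith
  refine ⟨hfin, ?_⟩
  have hvB : (∫ x in Ω, v x) ≤ volume.real Ω + B := by
    have i1 : IntegrableOn (fun _ : EuclideanSpace ℝ (Fin n) => (1:ℝ)) Ω :=
      integrableOn_of_cont hB continuous_const
    have : ∫ x in Ω, (1 + (1 - u x) ^ (-((p + 1) / 2)) * v x ^ (2 * b)) = volume.real Ω + B := by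
      rw [integral_add i1 iB, setIntegral_const, smul_eq_mul, mul_one]
    rw [← this]
    refine setIntegral_mono_on (integrableOn_of_cont hB S.hv.continuous) (i1.add iB) hms fun x hx => ?_
    have h1 : 1 ≤ (1 - u x) ^ (-((p + 1) / 2)) :=
      one_le_rpow_of_pos_of_le_one_of_nonpos (hpos x hx) (hle1 x hx) (by linarith)
    have hv0 := S.vp x hx
    have h2 : 0 ≤ v x ^ (2 * b) := rpow_nonneg hv0 _
    rcases le_total (v x) 1 with h | h
    · nlinarith
    · have : v x ≤ v x ^ (2 * b) := by
        conv_lhs => rw [← rpow_one (v x)]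
        exact rpow_le_rpow_of_exponent_le h (by linarith)
      nlinarith
  have := mul_le_mul_of_nonneg_left hfin (rpow_nonneg hτp.le (2 * b))
  linarith

theorem lam_bound {n : ℕ} {Ω : Set (EuclideanSpace ℝ (Fin n))} (hΩ : GoodDomain Ω)
    {p : ℝ} (hp : 1 < p) : ∃ Λ : ℝ, 0 < Λ ∧ ∀ lam u v, 0 < lam → Sys Ω p lam u v → lam ≤ Λ := by
  obtain ⟨hO, hB, x0, hx0⟩ := hΩ
  obtain ⟨R, hR, hball⟩ := Metric.isOpen_iff.1 hO x0 hx0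
  let f : ContDiffBump x0 := ⟨R / 4, R / 2, by linarith, by linarith⟩
  have hf : ContDiff ℝ (⊤ : ℕ∞) (f : EuclideanSpace ℝ (Fin n) → ℝ) := f.contDiff
  have hts : tsupport f ⊆ Ω := by
    rw [f.tsupport_eq]
    exact (Metric.closedBall_subset_ball (show R / 2 < R by linarith)).trans hball
  set G := ∫ x in Ω, ‖gradient f x‖ ^ 2 with hG
  set I := ∫ x in Ω, (f x) ^ 2 with hI
  have hfi : IntegrableOn (fun x => (f x) ^ 2) Ω := integrableOn_of_cont hB (hf.continuous.pow 2)
  have hIp : 0 < I := by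
    rw [hI, setIntegral_pos_iff_support_of_nonneg_ae (ae_of_all _ fun x => sq_nonneg _) hfi]
    have : Metric.ball x0 (R / 2) ⊆ (Function.support fun x => (f x) ^ 2) ∩ Ω := by
      intro x hx
      refine ⟨?_, hball (Metric.ball_subset_ball (by linarith) hx)⟩
      have := f.pos_of_mem_ball hx
      simp [this.ne']
    exact lt_of_lt_of_le (Metric.measure_ball_pos _ _ (by linarith)) (measure_mono this)
  have hG0 : 0 ≤ G := integral_nonneg fun x => sq_nonneg _
  have hr : 0 < √p := Real.sqrt_pos.2 (by linarith)
  refine ⟨(G / (√p * I)) ^ 2 + 1, by positivity, ?_⟩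
  intro lam u v hlam S
  have hs : 0 < √lam := Real.sqrt_pos.2 hlam
  have h1 := S.stab f hf f.hasCompactSupport hts
  have h2 : I ≤ ∫ x in Ω, (1 - u x) ^ (-((p + 1) / 2)) * (f x) ^ 2 := by
    refine setIntegral_mono_on hfi (integrableOn_of_closure hB
      ((cont_h ⟨hO, hB, x0, hx0⟩ S _).mul (hf.continuous.pow 2).continuousOn)) hO.measurableSet
      fun x hx => ?_
    have h1 : 1 ≤ (1 - u x) ^ (-((p + 1) / 2)) :=
      one_le_rpow_of_pos_of_le_one_of_nonpos (by linarith [S.u1 x hx]) (by linarith [S.up x hx])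
        (by linarith)
    nlinarith [sq_nonneg (f x)]
  have h3 : √lam * √p * I ≤ G := (mul_le_mul_of_nonneg_left h2 (mul_pos hs hr).le).trans h1
  have h4 : √lam ≤ G / (√p * I) := by
    rw [le_div_iff₀ (by positivity)]; linarith
  have h5 : lam = √lam ^ 2 := (Real.sq_sqrt hlam.le).symm
  rw [h5]
  have := pow_le_pow_left₀ hs.le h4 2
  linarith

/-- The heat kernel centred at `x0`. -/
def hk {n : ℕ} (x0 : EuclideanSpace ℝ (Fin n)) (t : ℝ) (y : EuclideanSpace ℝ (Fin n)) : ℝ :=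
  (4 * π * t) ^ (-((n : ℝ) / 2)) * rexp (-(1 / (4 * t)) * ‖y - x0‖ ^ 2)

theorem hk_smooth {n : ℕ} (x0 : EuclideanSpace ℝ (Fin n)) (t : ℝ) :
    ContDiff ℝ (⊤ : ℕ∞) (hk x0 t) := by
  unfold hk
  exact contDiff_const.mul ((contDiff_const.mul ((contDiff_id.sub contDiff_const).norm_sq ℝ)).exp)

theorem hk_nonneg {n : ℕ} (x0 : EuclideanSpace ℝ (Fin n)) {t : ℝ} (ht : 0 < t)
    (y : EuclideanSpace ℝ (Fin n)) : 0 ≤ hk x0 t y := by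
  unfold hk; positivity

theorem hk_le {n : ℕ} (x0 : EuclideanSpace ℝ (Fin n)) {t : ℝ} (ht : 0 < t)
    (y : EuclideanSpace ℝ (Fin n)) : hk x0 t y ≤ (4 * π * t) ^ (-((n : ℝ) / 2)) := by
  unfold hk
  refine mul_le_of_le_one_right (by positivity) ?_
  rw [exp_le_one_iff]
  have : 0 ≤ (1 / (4 * t)) * ‖y - x0‖ ^ 2 := by positivity
  linarith

theorem hk_pd {n : ℕ} (x0 : EuclideanSpace ℝ (Fin n)) (t : ℝ) (i : Fin n)
    (y : EuclideanSpace ℝ (Fin n)) :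
    pd i (hk x0 t) y = (-(1 / (4 * t)) * (2 * (y i - x0 i))) * hk x0 t y := by
  have h1 : HasFDerivAt (fun y : EuclideanSpace ℝ (Fin n) => ‖y - x0‖ ^ 2)
      (2 • (innerSL ℝ (y - x0))) y := by
    have := ((hasStrictFDerivAt_norm_sq (y - x0)).hasFDerivAt).comp y
      ((hasFDerivAt_id y).sub_const x0)
    exact this
  have h2 := ((h1.const_mul (-(1 / (4 * t)))).exp.const_mul ((4 * π * t) ^ (-((n : ℝ) / 2)))).fderiv
  unfold pd
  rw [show hk x0 t = fun y => (4 * π * t) ^ (-((n : ℝ) / 2)) * rexp (-(1 / (4 * t)) * ‖y - x0‖ ^ 2)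
    from rfl, h2]
  have h3 : inner ℝ (y - x0) (EuclideanSpace.single i (1:ℝ)) = y i - x0 i := by
    rw [EuclideanSpace.inner_single_right]; simp
  simp only [_root_.smul_apply, smul_eq_mul, innerSL_apply_apply, h3]
  rw [nsmul_eq_mul]
  push_cast
  ring

theorem hk_lap {n : ℕ} (x0 : EuclideanSpace ℝ (Fin n)) {t : ℝ} (ht : 0 < t)
    (y : EuclideanSpace ℝ (Fin n)) :
    lap (hk x0 t) y = (‖y - x0‖ ^ 2 / (4 * t ^ 2) - n / (2 * t)) * hk x0 t y := by
  rw [lap_eq_pd (hk_smooth x0 t)]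
  have h : ∀ i : Fin n, pd i (pd i (hk x0 t)) y =
      ((y i - x0 i) ^ 2 / (4 * t ^ 2) - 1 / (2 * t)) * hk x0 t y := by
    intro i
    have e : pd i (hk x0 t) = fun y => (-(1 / (4 * t)) * (2 * (y i - x0 i))) * hk x0 t y :=
      funext fun y => hk_pd x0 t i y
    have h1 : HasFDerivAt (fun y : EuclideanSpace ℝ (Fin n) => (-(1 / (4 * t)) * (2 * (y i - x0 i))))
        ((-(1 / (4 * t))) • ((2:ℝ) • (EuclideanSpace.proj i : EuclideanSpace ℝ (Fin n) →L[ℝ] ℝ))) y :=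
      ((((EuclideanSpace.proj i : EuclideanSpace ℝ (Fin n) →L[ℝ] ℝ).hasFDerivAt).sub_const
        (x0 i)).const_mul 2).const_mul _
    rw [e, pd_mul i h1.differentiableAt ((hk_smooth x0 t).differentiable (by simp) y), hk_pd]
    have h3 : pd i (fun y : EuclideanSpace ℝ (Fin n) => (-(1 / (4 * t)) * (2 * (y i - x0 i)))) y
        = -(1 / (4 * t)) * 2 := by
      unfold pd
      rw [h1.fderiv]; simp
    rw [h3]
    field_simp
    ring
  rw [Finset.sum_congr rfl fun i _ => h i, ← Finset.sum_mul, Finset.sum_sub_distrib,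
    ← Finset.sum_div, EuclideanSpace.norm_sq_eq]
  simp
  left
  field_simp

theorem hk_deriv {n : ℕ} (x0 : EuclideanSpace ℝ (Fin n)) {t : ℝ} (ht : 0 < t)
    (y : EuclideanSpace ℝ (Fin n)) :
    HasDerivAt (fun s => hk x0 s y) (lap (hk x0 t) y) t := by
  rw [hk_lap x0 ht]
  unfold hk
  have h1 : HasDerivAt (fun s : ℝ => (4 * π * s) ^ (-((n : ℝ) / 2)))
      (4 * π * (-((n : ℝ) / 2)) * (4 * π * t) ^ (-((n : ℝ) / 2) - 1)) t := by
    have h0 : HasDerivAt (fun s : ℝ => 4 * π * s) (4 * π) t := by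
      simpa using (hasDerivAt_id t).const_mul (4 * π)
    exact h0.rpow_const (Or.inl (by positivity))
  have h2 : HasDerivAt (fun s : ℝ => -(1 / (4 * s)) * ‖y - x0‖ ^ 2)
      (1 / (4 * t ^ 2) * ‖y - x0‖ ^ 2) t := by
    have h0 : HasDerivAt (fun s : ℝ => -(1 / (4 * s))) (1 / (4 * t ^ 2)) t := by
      have := ((hasDerivAt_inv ht.ne').const_mul (-(1 / 4 : ℝ)))
      convert! this using 1
      · ext s; ring
      · field_simp
    exact h0.mul_const _
  convert! h1.mul h2.exp using 1
  rw [rpow_sub_one (by positivity)]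
  field_simp
  ring

theorem hk_int {n : ℕ} (x0 : EuclideanSpace ℝ (Fin n)) {t : ℝ} (ht : 0 < t) :
    Integrable (hk x0 t) ∧ ∫ y, hk x0 t y = 1 := by
  have hb : 0 < 1 / (4 * t) := by positivity
  have h1 := GaussianFourier.integral_rexp_neg_mul_sq_norm (V := EuclideanSpace ℝ (Fin n)) hb
  have h2 : ∫ y, hk x0 t y = 1 := by
    unfold hk
    rw [integral_const_mul, integral_sub_right_eq_self (fun y => rexp (-(1 / (4 * t)) * ‖y‖ ^ 2)), h1,
      finrank_euclideanSpace_fin, show π / (1 / (4 * t)) = 4 * π * t by field_simp,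
      ← rpow_add (by positivity), neg_add_cancel, rpow_zero]
  refine ⟨?_, h2⟩
  by_contra h
  rw [integral_undef h] at h2
  exact zero_ne_one h2

theorem hk_int_le {n : ℕ} {Ω : Set (EuclideanSpace ℝ (Fin n))} (x0 : EuclideanSpace ℝ (Fin n))
    {t : ℝ} (ht : 0 < t) : ∫ y in Ω, hk x0 t y ≤ 1 := by
  rw [← (hk_int x0 ht).2]
  exact setIntegral_le_integral (hk_int x0 ht).1 (ae_of_all _ (hk_nonneg x0 ht))

theorem hk_hasDeriv {n : ℕ} {Ω : Set (EuclideanSpace ℝ (Fin n))} (hO : IsOpen Ω)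
    (hB : Bornology.IsBounded Ω) (x0 : EuclideanSpace ℝ (Fin n)) {w : EuclideanSpace ℝ (Fin n) → ℝ}
    (hw : Continuous w) {t : ℝ} (ht : 0 < t) :
    HasDerivAt (fun s => ∫ y in Ω, w y * hk x0 s y) (∫ y in Ω, w y * lap (hk x0 t) y) t := by
  obtain ⟨R, hR⟩ := hB.subset_closedBall x0
  refine (hasDerivAt_integral_of_dominated_loc_of_deriv_le (s := Ioo (t / 2) (2 * t))
    (F := fun s y => w y * hk x0 s y) (F' := fun s y => w y * lap (hk x0 s) y)
    (bound := fun y => |w y| * ((R ^ 2 / t ^ 2 + n / t) * (2 * π * t) ^ (-((n : ℝ) / 2))))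
    (Ioo_mem_nhds (by linarith) (by linarith)) (Eventually.of_forall fun s => ?_) ?_ ?_ ?_ ?_ ?_).2
  · exact (hw.mul (hk_smooth x0 s).continuous).aestronglyMeasurable
  · exact integrableOn_of_cont hB (hw.mul (hk_smooth x0 t).continuous)
  · exact (hw.mul (lap_smooth (hk_smooth x0 t)).continuous).aestronglyMeasurable
  · filter_upwards [ae_restrict_mem hO.measurableSet] with y hy s hs
    have hs0 : 0 < s := by linarith [hs.1]
    have hRy : ‖y - x0‖ ≤ R := by simpa [dist_eq_norm] using hR hy
    have hR0 : 0 ≤ R := (norm_nonneg _).trans hRy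
    rw [Real.norm_eq_abs, abs_mul, hk_lap x0 hs0, abs_mul]
    refine mul_le_mul_of_nonneg_left ?_ (abs_nonneg _)
    refine mul_le_mul ?_ ?_ (abs_nonneg _) (by positivity)
    · have a1 : ‖y - x0‖ ^ 2 / (4 * s ^ 2) ≤ R ^ 2 / t ^ 2 := by
        refine div_le_div₀ (by positivity) (by gcongr) (by positivity) ?_
        nlinarith [hs.1]
      have a2 : (n:ℝ) / (2 * s) ≤ n / t :=
        div_le_div_of_nonneg_left (by positivity) ht (by linarith [hs.1])
      have a3 : 0 ≤ ‖y - x0‖ ^ 2 / (4 * s ^ 2) := by positivity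
      have a4 : 0 ≤ (n:ℝ) / (2 * s) := by positivity
      rw [abs_le]; constructor <;> linarith [show 0 ≤ R ^ 2 / t ^ 2 by positivity,
        show 0 ≤ (n:ℝ) / t by positivity]
    · rw [abs_of_nonneg (hk_nonneg x0 hs0 y)]
      refine (hk_le x0 hs0 y).trans ?_
      refine rpow_le_rpow_of_nonpos (by positivity) ?_ (by have : (0:ℝ) ≤ n := by positivity
                                                           linarith)
      nlinarith [hs.1, pi_pos]
  · exact integrableOn_of_cont hB (hw.abs.mul continuous_const)
  · exact ae_of_all _ fun y s hs => (hk_deriv x0 (by linarith [hs.1]) y).const_mul _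

theorem hk_tendsto {n : ℕ} {Ω : Set (EuclideanSpace ℝ (Fin n))} (hO : IsOpen Ω)
    (hB : Bornology.IsBounded Ω) {x0 : EuclideanSpace ℝ (Fin n)} (hx0 : x0 ∈ Ω)
    {w : EuclideanSpace ℝ (Fin n) → ℝ} (hw : Continuous w) :
    Tendsto (fun s => ∫ y in Ω, w y * hk x0 s y) (𝓝[>] 0) (𝓝 (w x0)) := by
  set f : EuclideanSpace ℝ (Fin n) → ℂ := fun y => ((Ω.indicator w y : ℝ) : ℂ) with hf
  have hfi : Integrable f := ((integrableOn_of_cont hB hw).integrable_indicator hO.measurableSet).ofReal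
  have hfc : ContinuousAt f x0 := by
    refine Complex.continuous_ofReal.continuousAt.comp ?_
    refine hw.continuousAt.congr ?_
    filter_upwards [hO.mem_nhds hx0] with y hy
    rw [indicator_of_mem hy]
  have h1 := Real.tendsto_integral_gaussian_smul' hfi hfc
  have hc : Tendsto (fun t : ℝ => 1 / (4 * π ^ 2) * t⁻¹) (𝓝[>] 0) atTop :=
    tendsto_inv_nhdsGT_zero.const_mul_atTop (by positivity)
  have h2 := (Complex.continuous_re.tendsto _).comp (h1.comp hc)
  have hx : (f x0).re = w x0 := by simp [hf, hx0]
  rw [hx] at h2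
  refine h2.congr' ?_
  filter_upwards [self_mem_nhdsWithin] with t ht
  have ht : 0 < t := ht
  have : ∀ y, ((π * ((1 / (4 * π ^ 2) * t⁻¹ : ℝ) : ℂ)) ^
      (Module.finrank ℝ (EuclideanSpace ℝ (Fin n)) / 2 : ℂ) *
      Complex.exp (-π ^ 2 * ((1 / (4 * π ^ 2) * t⁻¹ : ℝ) : ℂ) * ‖x0 - y‖ ^ 2)) • f y
      = ((Ω.indicator (fun y => w y * hk x0 t y) y : ℝ) : ℂ) := by
    intro y
    have e1 : ((π * ((1 / (4 * π ^ 2) * t⁻¹ : ℝ) : ℂ)) ^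
      (Module.finrank ℝ (EuclideanSpace ℝ (Fin n)) / 2 : ℂ)) =
        (((4 * π * t) ^ (-((n : ℝ) / 2)) : ℝ) : ℂ) := by
      rw [finrank_euclideanSpace_fin, rpow_neg (by positivity), ← inv_rpow (by positivity),
        Complex.ofReal_cpow (by positivity)]
      push_cast
      congr 1
      have : (π : ℂ) ≠ 0 := by exact_mod_cast pi_ne_zero
      have : (t : ℂ) ≠ 0 := by exact_mod_cast ht.ne'
      field_simp
    have e2 : Complex.exp (-π ^ 2 * ((1 / (4 * π ^ 2) * t⁻¹ : ℝ) : ℂ) * ‖x0 - y‖ ^ 2) =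
        ((rexp (-(1 / (4 * t)) * ‖y - x0‖ ^ 2) : ℝ) : ℂ) := by
      rw [norm_sub_rev]
      push_cast
      congr 1
      have : (π : ℂ) ≠ 0 := by exact_mod_cast pi_ne_zero
      have : (t : ℂ) ≠ 0 := by exact_mod_cast ht.ne'
      field_simp
    rw [e1, e2, hf, smul_eq_mul]
    by_cases hy : y ∈ Ω
    · simp only [indicator_of_mem hy]
      unfold hk
      push_cast
      ring
    · simp [indicator_of_notMem hy]
  simp only [Function.comp_apply, this]
  rw [integral_complex_ofReal, Complex.ofReal_re, integral_indicator hO.measurableSet]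

theorem hk_le2 {n : ℕ} (x0 : EuclideanSpace ℝ (Fin n)) {t : ℝ} (ht : 0 < t)
    (y : EuclideanSpace ℝ (Fin n)) : hk x0 t y ≤ t ^ (-((n : ℝ) / 2)) := by
  refine (hk_le x0 ht y).trans ?_
  have hn : (0:ℝ) ≤ n := by positivity
  refine rpow_le_rpow_of_nonpos ht ?_ (by linarith)
  nlinarith [pi_gt_three]

/-- The heat average of `(1-u)^(-p)`. -/
theorem step1 {n : ℕ} {Ω : Set (EuclideanSpace ℝ (Fin n))} (hΩ : GoodDomain Ω)
    {p lam : ℝ} (hp : 1 < p) {u v : EuclideanSpace ℝ (Fin n) → ℝ} (S : Sys Ω p lam u v)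
    {N K e : ℝ} (hNp : p < N) (hK : (∫ x in Ω, (1 - u x) ^ (-N)) ≤ K)
    (he : n * p / (2 * N) ≤ e) (x0 : EuclideanSpace ℝ (Fin n)) {σ : ℝ} (hσ : 0 < σ) (hσ1 : σ ≤ 1) :
    (∫ x in Ω, (1 - u x) ^ (-p) * hk x0 σ x) ≤ (1 + K) * σ ^ (-e) := by
  have hO := hΩ.1
  have hB := hΩ.2.1
  have hN : 0 < N := by linarith
  have hpos : ∀ x ∈ Ω, 0 < 1 - u x := fun x hx => by linarith [S.u1 x hx]
  have hA0 : 0 ≤ ∫ x in Ω, (1 - u x) ^ (-N) :=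
    setIntegral_nonneg hO.measurableSet fun x hx => rpow_nonneg (hpos x hx).le _
  set M := σ ^ (-((n:ℝ) / (2 * N))) with hM
  have hMp : 0 < M := rpow_pos_of_pos hσ _
  have igc := (hk_smooth x0 σ).continuous
  have ig : IntegrableOn (fun x => hk x0 σ x) Ω := integrableOn_of_cont hB igc
  have iN : IntegrableOn (fun x => (1 - u x) ^ (-N)) Ω := integrableOn_of_closure hB (cont_h hΩ S _)
  have hb : (∫ x in Ω, (1 - u x) ^ (-p) * hk x0 σ x) ≤
      ∫ x in Ω, (M ^ p * hk x0 σ x + (M ^ (p - N) * σ ^ (-((n : ℝ) / 2))) * (1 - u x) ^ (-N)) := by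
    refine setIntegral_mono_on (integrableOn_of_closure hB ((cont_h hΩ S _).mul igc.continuousOn))
      ((ig.const_mul _).add (iN.const_mul _)) hO.measurableSet fun x hx => ?_
    have hg0 := hk_nonneg x0 hσ x
    have hg1 := hk_le2 x0 hσ x
    have hh := hpos x hx
    have h1 : 0 < (1 - u x) ^ (-N) := rpow_pos_of_pos hh _
    have h2 : 0 < M ^ (p - N) := rpow_pos_of_pos hMp _
    have h3 : 0 < M ^ p := rpow_pos_of_pos hMp _
    have h4 : (1 - u x) ^ (-p) ≤ M ^ p + M ^ (p - N) * (1 - u x) ^ (-N) := by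
      rcases le_total (1 - u x)⁻¹ M with h | h
      · have : (1 - u x) ^ (-p) ≤ M ^ p := by
          rw [rpow_neg hh.le, ← inv_rpow hh.le]
          exact rpow_le_rpow (by positivity) h (by linarith)
        have := mul_pos h2 h1
        linarith
      · have : (1 - u x) ^ (-p) ≤ M ^ (p - N) * (1 - u x) ^ (-N) := by
          have e1 : (1 - u x) ^ (-p) = ((1 - u x)⁻¹) ^ (p - N) * (1 - u x) ^ (-N) := by
            rw [inv_rpow hh.le, ← rpow_neg hh.le, ← rpow_add hh]; congr 1; ring
          rw [e1]
          exact mul_le_mul_of_nonneg_right (rpow_le_rpow_of_nonpos hMp h (by linarith)) h1.le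
        linarith
    calc _ ≤ (M ^ p + M ^ (p - N) * (1 - u x) ^ (-N)) * hk x0 σ x :=
          mul_le_mul_of_nonneg_right h4 hg0
      _ = M ^ p * hk x0 σ x + M ^ (p - N) * (1 - u x) ^ (-N) * hk x0 σ x := by ring
      _ ≤ M ^ p * hk x0 σ x + M ^ (p - N) * (1 - u x) ^ (-N) * σ ^ (-((n : ℝ) / 2)) := by
          gcongr
      _ = _ := by ring
  have e1 : M ^ (p - N) * σ ^ (-((n : ℝ) / 2)) = M ^ p := by
    rw [hM, ← rpow_mul hσ.le, ← rpow_mul hσ.le, ← rpow_add hσ]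
    congr 1; field_simp; ring
  have e2 : M ^ p ≤ σ ^ (-e) := by
    rw [hM, ← rpow_mul hσ.le]
    refine rpow_le_rpow_of_exponent_ge hσ hσ1 ?_
    have : -((n:ℝ) / (2 * N)) * p = -(n * p / (2 * N)) := by ring
    rw [this]; linarith
  refine hb.trans ?_
  rw [integral_add (ig.const_mul _) (iN.const_mul _), integral_const_mul, integral_const_mul, e1]
  have h5 : 0 < M ^ p := rpow_pos_of_pos hMp _
  calc _ ≤ M ^ p * 1 + M ^ p * K := by
        have := hk_int_le (Ω := Ω) x0 hσ
        gcongr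
    _ = (1 + K) * M ^ p := by ring
    _ ≤ _ := mul_le_mul_of_nonneg_left e2 (by linarith)

theorem step2 {n : ℕ} {Ω : Set (EuclideanSpace ℝ (Fin n))} (hΩ : GoodDomain Ω)
    {p lam : ℝ} (hlam : 0 < lam) {u v : EuclideanSpace ℝ (Fin n) → ℝ} (S : Sys Ω p lam u v)
    {e Λ K Vb : ℝ} (hΛ : lam ≤ Λ) (hK0 : 0 ≤ K) (he1 : 1 < e) (x0 : EuclideanSpace ℝ (Fin n))
    (hV : (∫ x in Ω, v x) ≤ Vb)
    (h1 : ∀ σ, 0 < σ → σ ≤ 1 → (∫ x in Ω, (1 - u x) ^ (-p) * hk x0 σ x) ≤ (1 + K) * σ ^ (-e))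
    {s : ℝ} (hs : 0 < s) (hs1 : s ≤ 1) :
    (∫ x in Ω, v x * hk x0 s x) ≤ (Vb + Λ * (1 + K) / (e - 1)) * s ^ (1 - e) := by
  have hO := hΩ.1
  have hB := hΩ.2.1
  have hms := hO.measurableSet
  have hpos : ∀ x ∈ Ω, 0 < 1 - u x := fun x hx => by linarith [S.u1 x hx]
  have hV0 : 0 ≤ ∫ x in Ω, v x := setIntegral_nonneg hms S.vp
  set C2 := Λ * (1 + K) with hC2
  have hC20 : 0 ≤ C2 := by have : 0 < Λ := by linarith
                           positivity
  have hder : ∀ σ, 0 < σ → HasDerivAt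
      (fun σ => (∫ x in Ω, v x * hk x0 σ x) + C2 / (1 - e) * σ ^ (1 - e))
      ((∫ x in Ω, v x * lap (hk x0 σ) x) + C2 * σ ^ (-e)) σ := by
    intro σ hσ
    have h2 := (Real.hasDerivAt_rpow_const (p := 1 - e) (Or.inl hσ.ne')).const_mul (C2 / (1 - e))
    convert! (hk_hasDeriv hO hB x0 S.hv.continuous hσ).add h2 using 1
    have : 1 - e ≠ 0 := by linarith
    rw [show (1 - e - 1) = -e by ring]
    field_simp
  have hmono : MonotoneOn (fun σ => (∫ x in Ω, v x * hk x0 σ x) + C2 / (1 - e) * σ ^ (1 - e))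
      (Ioc 0 1) := by
    refine monotoneOn_of_deriv_nonneg (convex_Ioc 0 1)
      (fun σ hσ => (hder σ hσ.1).continuousAt.continuousWithinAt)
      (fun σ hσ => ?_) (fun σ hσ => ?_)
    · rw [interior_Ioc] at hσ
      exact (hder σ hσ.1).differentiableAt.differentiableWithinAt
    · rw [interior_Ioc] at hσ
      rw [(hder σ hσ.1).deriv]
      have hk1 := kato hO hB S.hv S.v0 S.vp (fun x hx => by
        rw [S.lv x hx, neg_nonpos]
        exact mul_nonneg hlam.le (rpow_nonneg (hpos x hx).le _)) (hk_smooth x0 σ)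
        (hk_nonneg x0 hσ.1)
      have e1 : ∫ x in Ω, hk x0 σ x * lap v x = -lam * ∫ x in Ω, (1 - u x) ^ (-p) * hk x0 σ x := by
        rw [← integral_const_mul]
        refine setIntegral_congr_fun hms fun x hx => ?_
        rw [S.lv x hx]; ring
      rw [e1] at hk1
      have h3 := h1 σ hσ.1 hσ.2.le
      have h4 : lam * (∫ x in Ω, (1 - u x) ^ (-p) * hk x0 σ x) ≤ C2 * σ ^ (-e) := by
        have h6 : 0 ≤ (1 + K) * σ ^ (-e) := mul_nonneg (by linarith) (rpow_nonneg hσ.1.le _)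
        calc _ ≤ lam * ((1 + K) * σ ^ (-e)) := mul_le_mul_of_nonneg_left h3 hlam.le
          _ ≤ Λ * ((1 + K) * σ ^ (-e)) := mul_le_mul_of_nonneg_right hΛ h6
          _ = _ := by rw [hC2]; ring
      linarith
  have hm := hmono ⟨hs, hs1⟩ ⟨one_pos, le_rfl⟩ hs1
  simp only [one_rpow, mul_one] at hm
  have hv1 : (∫ x in Ω, v x * hk x0 1 x) ≤ Vb := by
    refine le_trans (setIntegral_mono_on (integrableOn_of_cont hB
      (S.hv.continuous.mul (hk_smooth x0 1).continuous)) (integrableOn_of_cont hB S.hv.continuous) hms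
      fun x hx => ?_) hV
    have := hk_le2 x0 one_pos x
    rw [one_rpow] at this
    exact mul_le_of_le_one_right (S.vp x hx) this
  have hs2 : 1 ≤ s ^ (1 - e) := one_le_rpow_of_pos_of_le_one_of_nonpos hs hs1 (by linarith)
  have e3 : C2 / (1 - e) = - (C2 / (e - 1)) := by
    rw [show 1 - e = -(e - 1) by ring, div_neg]
  rw [e3] at hm
  have h7 : 0 ≤ C2 / (e - 1) := div_nonneg hC20 (by linarith)
  have h8 : Vb ≤ Vb * s ^ (1 - e) := le_mul_of_one_le_right (hV0.trans hV) hs2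
  nlinarith

theorem step3 {n : ℕ} {Ω : Set (EuclideanSpace ℝ (Fin n))} (hΩ : GoodDomain Ω)
    {p lam : ℝ} {u v : EuclideanSpace ℝ (Fin n) → ℝ} (S : Sys Ω p lam u v)
    {e C4 : ℝ} (he2 : e < 2) (hC4 : 0 ≤ C4) {x0 : EuclideanSpace ℝ (Fin n)} (hx0 : x0 ∈ Ω)
    (h1 : ∀ s, 0 < s → s ≤ 1 → (∫ x in Ω, v x * hk x0 s x) ≤ C4 * s ^ (1 - e))
    {t : ℝ} (ht : 0 < t) (ht1 : t ≤ 1) :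
    u x0 ≤ (∫ x in Ω, u x * hk x0 t x) + C4 / (2 - e) * t ^ (2 - e) := by
  have hO := hΩ.1
  have hB := hΩ.2.1
  have hms := hO.measurableSet
  have hder : ∀ σ, 0 < σ → HasDerivAt
      (fun σ => (∫ x in Ω, u x * hk x0 σ x) + C4 / (2 - e) * σ ^ (2 - e))
      ((∫ x in Ω, u x * lap (hk x0 σ) x) + C4 * σ ^ (1 - e)) σ := by
    intro σ hσ
    have h2 := (Real.hasDerivAt_rpow_const (p := 2 - e) (Or.inl hσ.ne')).const_mul (C4 / (2 - e))
    convert! (hk_hasDeriv hO hB x0 S.hu.continuous hσ).add h2 using 1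
    have : 2 - e ≠ 0 := by linarith
    rw [show (2 - e - 1) = 1 - e by ring]
    field_simp
  have hmono : MonotoneOn (fun σ => (∫ x in Ω, u x * hk x0 σ x) + C4 / (2 - e) * σ ^ (2 - e))
      (Ioc 0 1) := by
    refine monotoneOn_of_deriv_nonneg (convex_Ioc 0 1)
      (fun σ hσ => (hder σ hσ.1).continuousAt.continuousWithinAt)
      (fun σ hσ => ?_) (fun σ hσ => ?_)
    · rw [interior_Ioc] at hσ
      exact (hder σ hσ.1).differentiableAt.differentiableWithinAt
    · rw [interior_Ioc] at hσ
      rw [(hder σ hσ.1).deriv]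
      have hk1 := kato hO hB S.hu S.u0 S.up (fun x hx => by
        rw [S.lu x, neg_nonpos]; exact S.vp x hx) (hk_smooth x0 σ) (hk_nonneg x0 hσ.1)
      have e1 : ∫ x in Ω, hk x0 σ x * lap u x = - ∫ x in Ω, v x * hk x0 σ x := by
        rw [← integral_neg]
        refine setIntegral_congr_fun hms fun x hx => ?_
        rw [S.lu x]; ring
      rw [e1] at hk1
      have h3 := h1 σ hσ.1 hσ.2.le
      linarith
  refine le_of_tendsto (hk_tendsto hO hB hx0 S.hu.continuous) ?_
  filter_upwards [Ioo_mem_nhdsGT ht] with s hs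
  have hm := hmono ⟨hs.1, hs.2.le.trans ht1⟩ ⟨ht, ht1⟩ hs.2.le
  have : 0 ≤ C4 / (2 - e) * s ^ (2 - e) :=
    mul_nonneg (div_nonneg hC4 (by linarith)) (rpow_nonneg hs.1.le _)
  simp only at hm
  linarith

theorem tangent {N x : ℝ} (hN : 0 < N) (hx : 0 < x) : 1 - N * (x - 1) ≤ x ^ (-N) := by
  rw [rpow_def_of_pos hx]
  have h1 := add_one_le_exp (log x * -N)
  have h2 := log_le_sub_one_of_pos hx
  nlinarith

theorem step4 {n : ℕ} {Ω : Set (EuclideanSpace ℝ (Fin n))} (hΩ : GoodDomain Ω)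
    {p lam : ℝ} {u v : EuclideanSpace ℝ (Fin n) → ℝ} (S : Sys Ω p lam u v)
    {N K m : ℝ} (hN : 0 < N) (hK : (∫ x in Ω, (1 - u x) ^ (-N)) ≤ K) (x0 : EuclideanSpace ℝ (Fin n))
    {t : ℝ} (ht : 0 < t) (ht1 : t ≤ 1) (hm0 : 0 < m) (hm : 1 - (∫ x in Ω, u x * hk x0 t x) ≤ m) :
    (K + 1) ^ (-(1 / N)) * t ^ ((n:ℝ) / (2 * N)) ≤ m := by
  have hO := hΩ.1
  have hB := hΩ.2.1
  have hms := hO.measurableSet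
  have hpos : ∀ x ∈ Ω, 0 < 1 - u x := fun x hx => by linarith [S.u1 x hx]
  have hK0 : 0 ≤ K := le_trans (setIntegral_nonneg hms fun x hx => rpow_nonneg (hpos x hx).le _) hK
  have hmN : 0 < m ^ (-N) := rpow_pos_of_pos hm0 _
  have key : ∀ h : ℝ, 0 < h → m ^ (-N) * (1 + N - N / m * h) ≤ h ^ (-N) := by
    intro h hh
    have h1 := tangent hN (div_pos hh hm0)
    rw [div_rpow hh.le hm0.le, le_div_iff₀ hmN] at h1
    refine le_trans (le_of_eq ?_) h1
    field_simp
    ring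
  set I := ∫ x in Ω, hk x0 t x with hI
  have hI1 : I ≤ 1 := hk_int_le x0 ht
  set U := ∫ x in Ω, u x * hk x0 t x with hU
  have igc := (hk_smooth x0 t).continuous
  have ig : IntegrableOn (fun x => hk x0 t x) Ω := integrableOn_of_cont hB igc
  have iu : IntegrableOn (fun x => u x * hk x0 t x) Ω := integrableOn_of_cont hB (S.hu.continuous.mul igc)
  have iN : IntegrableOn (fun x => (1 - u x) ^ (-N)) Ω := integrableOn_of_closure hB (cont_h hΩ S _)
  have h1 : m ^ (-N) * ((1 + N - N / m) * I + N / m * U) ≤ t ^ (-((n:ℝ) / 2)) * K := by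
    calc m ^ (-N) * ((1 + N - N / m) * I + N / m * U)
        = ∫ x in Ω, m ^ (-N) * ((1 + N - N / m) * hk x0 t x + N / m * (u x * hk x0 t x)) := by
          rw [integral_const_mul, integral_add (ig.const_mul _) (iu.const_mul _), integral_const_mul,
            integral_const_mul]
      _ ≤ ∫ x in Ω, t ^ (-((n:ℝ) / 2)) * (1 - u x) ^ (-N) := by
          refine setIntegral_mono_on (((ig.const_mul _).add (iu.const_mul _)).const_mul _)
            (iN.const_mul _) hms fun x hx => ?_
          have hg0 := hk_nonneg x0 ht x
          have h2 := mul_le_mul_of_nonneg_right (key _ (hpos x hx)) hg0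
          have h3 := mul_le_mul_of_nonneg_right (hk_le2 x0 ht x) (rpow_nonneg (hpos x hx).le (-N))
          calc _ = m ^ (-N) * (1 + N - N / m * (1 - u x)) * hk x0 t x := by ring
            _ ≤ _ := h2
            _ = _ := mul_comm _ _
            _ ≤ _ := h3
      _ ≤ _ := by
          rw [integral_const_mul]
          exact mul_le_mul_of_nonneg_left hK (rpow_nonneg ht.le _)
  have h2 := key 1 one_pos
  rw [one_rpow, mul_one] at h2
  have h3 := mul_le_mul_of_nonneg_right h2 (show 0 ≤ 1 - I by linarith)
  have h4 : m ^ (-N) ≤ t ^ (-((n:ℝ) / 2)) * K + 1 := by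
    have h5 : m ^ (-N) * (N / m * (1 - U)) ≤ m ^ (-N) * N := by
      refine mul_le_mul_of_nonneg_left ?_ hmN.le
      calc N / m * (1 - U) ≤ N / m * m := mul_le_mul_of_nonneg_left hm (by positivity)
        _ = N := by field_simp
    have hI0 : 0 ≤ I := integral_nonneg (hk_nonneg x0 ht)
    nlinarith
  have ht2 : 1 ≤ t ^ (-((n:ℝ) / 2)) := one_le_rpow_of_pos_of_le_one_of_nonpos ht ht1 (by
    have : (0:ℝ) ≤ n := by positivity
    linarith)
  have h5 : m ^ (-N) ≤ (K + 1) * t ^ (-((n:ℝ) / 2)) := by nlinarith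
  have h6 := rpow_le_rpow_of_nonpos hmN h5 (show -(1 / N) ≤ 0 by
    have : 0 < 1 / N := by positivity
    linarith)
  rw [mul_rpow (by linarith) (rpow_nonneg ht.le _), ← rpow_mul ht.le, ← rpow_mul hm0.le] at h6
  rw [show -N * -(1 / N) = 1 by field_simp, rpow_one,
    show -((n:ℝ) / 2) * -(1 / N) = n / (2 * N) by field_simp] at h6
  exact h6

theorem sup_est {n : ℕ} {Ω : Set (EuclideanSpace ℝ (Fin n))} (hΩ : GoodDomain Ω)
    {p : ℝ} (hp : 1 < p) {N K Λ Vb : ℝ} (hNp : p < N) (hNn : (p + 1) * n / 4 < N)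
    (hK0 : 0 ≤ K) (hΛ0 : 0 < Λ) (hVb : 0 ≤ Vb) :
    ∃ δ : ℝ, 0 < δ ∧ ∀ lam u v, 0 < lam → lam ≤ Λ → Sys Ω p lam u v →
      (∫ x in Ω, (1 - u x) ^ (-N)) ≤ K → (∫ x in Ω, v x) ≤ Vb → ∀ x ∈ Ω, u x ≤ 1 - δ := by
  have hN : 0 < N := by linarith
  have hn0 : (0:ℝ) ≤ n := by positivity
  set θ := (n:ℝ) / (2 * N) with hθ
  have hθ0 : 0 ≤ θ := by positivity
  have hθp : θ * (p + 1) < 2 := by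
    rw [hθ, div_mul_eq_mul_div, div_lt_iff₀ (by positivity)]; linarith
  have hθ1 : θ < 1 := by nlinarith
  obtain ⟨e, hel, heu⟩ : ∃ e, max 1 (θ * p) < e ∧ e < 2 - θ :=
    exists_between (max_lt (by linarith) (by linarith))
  have he1 : 1 < e := (le_max_left _ _).trans_lt hel
  have hep : (n:ℝ) * p / (2 * N) ≤ e := by
    have := (le_max_right 1 (θ * p)).trans hel.le
    rw [hθ] at this
    calc _ = (n:ℝ) / (2 * N) * p := by ring
      _ ≤ _ := this
  have he2 : e < 2 := by linarith
  set C4 := Vb + Λ * (1 + K) / (e - 1) with hC4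
  have hC40 : 0 ≤ C4 := by
    have : 0 < e - 1 := by linarith
    positivity
  set C5 := C4 / (2 - e) with hC5
  have hC50 : 0 ≤ C5 := div_nonneg hC40 (by linarith)
  set C6 := (K + 1) ^ (-(1 / N)) with hC6
  have hC60 : 0 < C6 := rpow_pos_of_pos (by linarith) _
  obtain ⟨t, ht, ht1, hts⟩ : ∃ t : ℝ, 0 < t ∧ t ≤ 1 ∧ C5 * t ^ (2 - e - θ) < C6 / 2 := by
    have hμ : 0 < 2 - e - θ := by linarith
    have h1 : Tendsto (fun t : ℝ => C5 * t ^ (2 - e - θ)) (𝓝 0) (𝓝 (C5 * 0 ^ (2 - e - θ))) :=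
      ((continuousAt_rpow_const 0 _ (Or.inr hμ.le)).tendsto).const_mul C5
    rw [zero_rpow hμ.ne', mul_zero] at h1
    have h2 : ∀ᶠ t in 𝓝[>] (0:ℝ), C5 * t ^ (2 - e - θ) < C6 / 2 :=
      (h1.mono_left nhdsWithin_le_nhds).eventually (gt_mem_nhds (by positivity))
    obtain ⟨t, h3, h4⟩ := (h2.and (Ioc_mem_nhdsGT one_pos)).exists
    exact ⟨t, h4.1, h4.2, h3⟩
  have htθ : 0 < t ^ θ := rpow_pos_of_pos ht _
  refine ⟨C6 / 2 * t ^ θ, by positivity, ?_⟩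
  intro lam u v hlam hlamΛ S hK hV x0 hx0
  have s1 := fun σ (h : 0 < σ) (h1 : σ ≤ 1) => step1 hΩ hp S hNp hK hep x0 h h1
  have s2 := fun s (h : 0 < s) (h1 : s ≤ 1) => step2 hΩ hlam S hlamΛ hK0 he1 x0 hV s1 h h1
  have s3 := step3 hΩ S he2 hC40 hx0 s2 ht ht1
  have htp : 0 ≤ t ^ (2 - e) := rpow_nonneg ht.le _
  have hux := S.u1 x0 hx0
  have s4 := step4 hΩ S hN hK x0 ht ht1 (m := 1 - u x0 + C5 * t ^ (2 - e))
    (by have := mul_nonneg hC50 htp; linarith) (by linarith)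
  have e1 : C5 * t ^ (2 - e) = C5 * t ^ (2 - e - θ) * t ^ θ := by
    rw [mul_assoc, ← rpow_add ht]; congr 2; ring
  have h9 := mul_lt_mul_of_pos_right hts htθ
  rw [← e1] at h9
  linarith

theorem quartic_scale {p : ℝ} (hp : 1 < p) (b : ℝ) :
    (b * (p - 1) / (p + 1)) ^ 4 - 8 * p * (p - 1) / (p + 1) ^ 2 * (b * (p - 1) / (p + 1)) ^ 2
      + 4 * p * (p - 1) * (p - 3) / (p + 1) ^ 3 * (b * (p - 1) / (p + 1))
      + 4 * p * (p - 1) ^ 2 / (p + 1) ^ 4 =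
    (p - 1) ^ 2 / (p + 1) ^ 4 * ((p - 1) ^ 2 * b ^ 4 - 4 * p * (b * (p - 1) + 1) * (2 * b - 1)) := by
  have h2 : p + 1 ≠ 0 := by linarith
  field_simp
  ring

set_option maxHeartbeats 1600000 in
theorem choose_b {p : ℝ} (hp : 1 < p) {n : ℕ} {αstar : ℝ}
    (hroot : αstar ^ 4 - 8 * p * (p - 1) / (p + 1) ^ 2 * αstar ^ 2
      + 4 * p * (p - 1) * (p - 3) / (p + 1) ^ 3 * αstar + 4 * p * (p - 1) ^ 2 / (p + 1) ^ 4 = 0)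
    (hmax : ∀ β : ℝ, β ^ 4 - 8 * p * (p - 1) / (p + 1) ^ 2 * β ^ 2
      + 4 * p * (p - 1) * (p - 3) / (p + 1) ^ 3 * β + 4 * p * (p - 1) ^ 2 / (p + 1) ^ 4 = 0 →
      β ≤ αstar)
    (hn : (n : ℝ) < 4 * αstar + 2) :
    ∃ b : ℝ, 1 ≤ b ∧ (p + 1) * n / 4 < (p + 1) / 2 + b * (p - 1) ∧
      (b * (p - 1) / 2) ^ 2 / (2 * (b * (p - 1) / 2) + 1) * (b ^ 2 / (2 * b - 1)) < p := by
  have hp1 : 0 < p - 1 := by linarith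
  have hp2 : 0 < p + 1 := by linarith
  have hcoef : 0 < (p - 1) ^ 2 / (p + 1) ^ 4 := by positivity
  set s := αstar * (p + 1) / (p - 1) with hs
  have hsα : αstar = s * (p - 1) / (p + 1) := by rw [hs]; field_simp
  set q : ℝ → ℝ := fun b => (p - 1) ^ 2 * b ^ 4 - 4 * p * (b * (p - 1) + 1) * (2 * b - 1) with hq
  have hqs : q s = 0 := by
    rw [hsα, quartic_scale hp] at hroot
    rcases mul_eq_zero.1 hroot with h | h
    · exact absurd h hcoef.ne'
    · exact h
  have hq1 : q 1 < 0 := by simp only [hq]; nlinarith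
  have hs1 : 1 < s := by
    set B := 1 + 3 * p / (p - 1) with hB
    have hB1 : 1 ≤ B := by
      have : 0 < 3 * p / (p - 1) := by positivity
      linarith
    have hBp : (p - 1) * B = (p - 1) + 3 * p := by rw [hB]; field_simp
    have hqB : 0 ≤ q B := by
      have h1 : (B * (p - 1) + 1) * (2 * B - 1) ≤ (p * B) * (2 * B) := by
        apply mul_le_mul <;> nlinarith
      have h2 : 9 * p ^ 2 ≤ ((p - 1) * B) ^ 2 := by rw [hBp]; nlinarith
      have h3 : 4 * p * ((B * (p - 1) + 1) * (2 * B - 1)) ≤ 4 * p * ((p * B) * (2 * B)) :=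
        mul_le_mul_of_nonneg_left h1 (by linarith)
      have h4 := mul_le_mul_of_nonneg_right h2 (sq_nonneg B)
      have h5 : 0 ≤ p ^ 2 * B ^ 2 := by positivity
      simp only [hq]
      nlinarith
    have hqc : ContinuousOn q (Icc 1 B) := by
      apply Continuous.continuousOn; simp only [hq]; fun_prop
    obtain ⟨c, hc, hc0⟩ := intermediate_value_Icc hB1 hqc ⟨hq1.le, hqB⟩
    have hc1 : 1 < c := lt_of_le_of_ne hc.1 (by rintro rfl; linarith)
    have := hmax (c * (p - 1) / (p + 1)) (by
      rw [quartic_scale hp]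
      exact mul_eq_zero_of_right _ hc0)
    rw [hsα] at this
    have h6 : c ≤ s := by
      have h7 := (div_le_div_iff_of_pos_right hp2).1 this
      exact le_of_mul_le_mul_right h7 hp1
    linarith
  have hb0 : ((p + 1) * n / 4 - (p + 1) / 2) / (p - 1) < s := by
    rw [hs]
    refine (div_lt_div_iff_of_pos_right hp1).2 ?_
    nlinarith
  obtain ⟨b, hbl, hbs⟩ := exists_between (max_lt hs1 hb0)
  have hb1 : 1 < b := (le_max_left _ _).trans_lt hbl
  have hb2 := (le_max_right _ _).trans_lt hbl
  rw [div_lt_iff₀ hp1] at hb2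
  refine ⟨b, hb1.le, by linarith, ?_⟩
  have hX : 0 < b * (p - 1) + 1 := by positivity
  have hY : 0 < 2 * b - 1 := by linarith
  have hXs : 0 < s * (p - 1) + 1 := by positivity
  have hYs : 0 < 2 * s - 1 := by linarith
  have i1 : b ^ 2 * (s * (p - 1) + 1) < s ^ 2 * (b * (p - 1) + 1) := by
    have h1 : 0 < (s - b) * (b * s * (p - 1) + (s + b)) := by
      have : 0 < s - b := by linarith
      positivity
    nlinarith
  have i2 : b ^ 2 * (2 * s - 1) ≤ s ^ 2 * (2 * b - 1) := by
    have h1 : 0 ≤ (s - b) * (2 * b * s - (s + b)) := by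
      apply mul_nonneg <;> nlinarith
    nlinarith
  have i3 : (b ^ 2 * (s * (p - 1) + 1)) * (b ^ 2 * (2 * s - 1)) <
      (s ^ 2 * (b * (p - 1) + 1)) * (s ^ 2 * (2 * b - 1)) :=
    mul_lt_mul i1 i2 (by positivity) (by positivity)
  have i4 : (p - 1) ^ 2 * b ^ 4 < 4 * p * ((b * (p - 1) + 1) * (2 * b - 1)) := by
    have h1 : (p - 1) ^ 2 * s ^ 4 = 4 * p * (s * (p - 1) + 1) * (2 * s - 1) := by
      have := hqs; simp only [hq] at this; linarith
    have h2 := mul_lt_mul_of_pos_left i3 (show 0 < (p - 1) ^ 2 by positivity)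
    have h3 : ((s * (p - 1) + 1) * (2 * s - 1)) * ((p - 1) ^ 2 * b ^ 4) <
        ((s * (p - 1) + 1) * (2 * s - 1)) * (4 * p * ((b * (p - 1) + 1) * (2 * b - 1))) := by
      calc _ = (p - 1) ^ 2 * ((b ^ 2 * (s * (p - 1) + 1)) * (b ^ 2 * (2 * s - 1))) := by ring
        _ < _ := h2
        _ = ((p - 1) ^ 2 * s ^ 4) * ((b * (p - 1) + 1) * (2 * b - 1)) := by ring
        _ = _ := by rw [h1]; ring
    exact lt_of_mul_lt_mul_left h3 (by positivity)
  rw [div_mul_div_comm, div_lt_iff₀ (by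
    rw [show 2 * (b * (p - 1) / 2) + 1 = b * (p - 1) + 1 by ring]; positivity)]
  rw [show 2 * (b * (p - 1) / 2) + 1 = b * (p - 1) + 1 by ring]
  nlinarith

theorem main_est {n : ℕ} {Ω : Set (EuclideanSpace ℝ (Fin n))} (hΩ : GoodDomain Ω)
    {p : ℝ} (hp : 1 < p) {b : ℝ} (hb : 1 ≤ b)
    (hbn : (p + 1) * n / 4 < (p + 1) / 2 + b * (p - 1))
    (hcc : (b * (p - 1) / 2) ^ 2 / (2 * (b * (p - 1) / 2) + 1) * (b ^ 2 / (2 * b - 1)) < p) :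
    ∃ δ : ℝ, 0 < δ ∧ ∀ lam u v, 0 < lam → Sys Ω p lam u v → ∀ x ∈ Ω, u x ≤ 1 - δ := by
  obtain ⟨Λ, hΛ, hlamΛ⟩ := lam_bound hΩ hp
  have hp1 : 0 < p - 1 := by linarith
  have hp0 : 0 < p := by linarith
  obtain ⟨a, ha⟩ : ∃ a, a = b * (p - 1) / 2 := ⟨_, rfl⟩
  obtain ⟨N, hN⟩ : ∃ N, N = (p + 1) / 2 + b * (p - 1) := ⟨_, rfl⟩
  rw [← ha] at hcc
  rw [← hN] at hbn
  obtain ⟨c1, hc1⟩ : ∃ c, c = a ^ 2 / (2 * a + 1) := ⟨_, rfl⟩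
  obtain ⟨c2, hc2⟩ : ∃ c, c = b ^ 2 / (2 * b - 1) := ⟨_, rfl⟩
  rw [← hc1, ← hc2] at hcc
  obtain ⟨ε, hε⟩ : ∃ ε, ε = (p - c1 * c2) / (2 * p) := ⟨_, rfl⟩
  have hεp : 0 < ε := by rw [hε]; exact div_pos (by linarith) (by positivity)
  have hc20 : 0 ≤ c2 := by rw [hc2]; exact div_nonneg (by positivity) (by linarith)
  obtain ⟨K, hK⟩ : ∃ K, K = 2 * p * ((2 / ε) ^ (N / a) * volume.real Ω) / (p - c1 * c2) := ⟨_, rfl⟩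
  have hvol : 0 ≤ volume.real Ω := measureReal_nonneg
  have hK0 : 0 ≤ K := by
    rw [hK]; exact div_nonneg (by positivity) (by linarith)
  obtain ⟨δ, hδ, H⟩ := sup_est hΩ hp (N := N) (K := K) (Λ := Λ)
    (Vb := volume.real Ω + (c2 * √Λ / √p) ^ (2 * b) * K) (by rw [hN]; nlinarith) hbn hK0 hΛ
    (by positivity)
  refine ⟨δ, hδ, fun lam u v hlam S => ?_⟩
  have hle := hlamΛ lam u v hlam S
  obtain ⟨h1, h2⟩ := int_est hΩ hp hlam S hb ha hN hc1 hc2 hε hcc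
  rw [← hK] at h1 h2
  refine H lam u v hlam hle S h1 (h2.trans ?_)
  have : c2 * √lam / √p ≤ c2 * √Λ / √p := by gcongr
  have h3 : (c2 * √lam / √p) ^ (2 * b) ≤ (c2 * √Λ / √p) ^ (2 * b) :=
    rpow_le_rpow (by positivity) this (by linarith)
  gcongr

/-- For the singular nonlinearity `f(u) = (1−u)^{−p}` with `p > 1`: a sequence of semistable
solutions of `(N_{λ_m})` satisfying the stability inequality satisfies
`sup_m ‖u_m‖_{L^∞(Ω)} < 1` whenever `n < 4α* + 2`, where `α*` is the largest root of
`α⁴ − (8p(p−1)/(p+1)²)α² + (4p(p−1)(p−3)/(p+1)³)α + 4p(p−1)²/(p+1)⁴`. -/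
theorem statement5 {n : ℕ} (Ω : Set (EuclideanSpace ℝ (Fin n))) (hΩ : GoodDomain Ω)
    (p : ℝ) (hp : 1 < p)
    (lam : ℕ → ℝ) (hlam : ∀ m, 0 < lam m)
    (u : ℕ → EuclideanSpace ℝ (Fin n) → ℝ)
    (hsol : ∀ m, Solves Ω (1 : EReal) (lam m) (fun t => (1 - t) ^ (-p)) (u m))
    (hsemi : ∀ m, Semistable Ω (lam m) (fun t => (1 - t) ^ (-p)) (u m))
    (hstab : ∀ m, StabIneq Ω (lam m) (fun t => (1 - t) ^ (-p)) (u m))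
    (αstar : ℝ)
    (hroot : αstar ^ 4 - 8 * p * (p - 1) / (p + 1) ^ 2 * αstar ^ 2
      + 4 * p * (p - 1) * (p - 3) / (p + 1) ^ 3 * αstar + 4 * p * (p - 1) ^ 2 / (p + 1) ^ 4 = 0)
    (hmax : ∀ β : ℝ, β ^ 4 - 8 * p * (p - 1) / (p + 1) ^ 2 * β ^ 2
      + 4 * p * (p - 1) * (p - 3) / (p + 1) ^ 3 * β + 4 * p * (p - 1) ^ 2 / (p + 1) ^ 4 = 0 →
      β ≤ αstar)
    (hn : (n : ℝ) < 4 * αstar + 2) :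
    ∃ C : ℝ, C < 1 ∧ ∀ m, ∀ x ∈ Ω, u m x ≤ C := by
  obtain ⟨b, hb, hbn, hcc⟩ := choose_b hp hroot hmax hn
  obtain ⟨δ, hδ, H⟩ := main_est hΩ hp hb hbn hcc
  refine ⟨1 - δ, by linarith, fun m => ?_⟩
  exact H (lam m) (u m) _ (hlam m) (sys_of hΩ hp (hlam m) (hsol m) (hstab m))

end
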